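/- arXiv:0910.4503 — 14 statements merged into one kernel-verified Lean document; each statement's English description precedes it below -/
import Mathlib

section
/- Let X and Y be real Banach spaces, let G : X → Y be a Daugavet center, let E be a real Banach space containing Y as a closed linear subspace, and let J : Y → E be the inclusion map. Then there exists a norm |||·||| on E which is equivalent to the original norm of E, coincides with the original norm on Y, and such that the composition J ∘ G : X → (E, |||·|||) is a Daugavet center (operator norms taken with respect to |||·|||). -/
/-- A bounded linear operator `G : X → Y` between real normed spaces is a *Daugavet center*
if `‖G + T‖ = ‖G‖ + ‖T‖` for every operator `T` of rank at most one, i.e. every operator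
of the form `x ↦ x*(x) • y`. -/
def IsDaugavetCenter {X Y : Type*} [NormedAddCommGroup X] [NormedSpace ℝ X]
    [NormedAddCommGroup Y] [NormedSpace ℝ Y] (G : X →L[ℝ] Y) : Prop :=
  ∀ (x' : X →L[ℝ] ℝ) (y : Y), ‖G + x'.smulRight y‖ = ‖G‖ + ‖x'.smulRight y‖

/-- The operator norm of `T : X → E` computed with respect to a (new) norm `N` on the
codomain `E` (and the original norm on the domain `X`). -/
noncomputable def opNormWith {X E : Type*} [NormedAddCommGroup X] [NormedSpace ℝ X]
    [NormedAddCommGroup E] [NormedSpace ℝ E] (N : E → ℝ) (T : X →L[ℝ] E) : ℝ :=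
  sSup {c : ℝ | ∃ x : X, ‖x‖ ≤ 1 ∧ c = N (T x)}

section SlicewiseNorm

variable {E : Type*} [NormedAddCommGroup E] [NormedSpace ℝ E]

/-- The slice of the dual unit ball of `E` determined by `y` and the level `a`. -/
def dualSlice (y : E) (a : ℝ) : Set (E →L[ℝ] ℝ) :=
  {g | ‖g‖ ≤ 1 ∧ a < g y}

theorem dualSlice_nonempty {y : E} {a : ℝ} (h : a < ‖y‖) : (dualSlice y a).Nonempty := by
  obtain ⟨g, hg, hgy⟩ := exists_dual_vector'' ℝ y
  exact ⟨g, hg, by simpa [hgy] using h⟩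

/-- A set of functionals is somewhere dense relative to `Y` if it meets every slice, defined by
an element of `Y`, that is contained in some fixed such slice. -/
def SomewhereSliceDense (Y : Submodule ℝ E) (A : Set (E →L[ℝ] ℝ)) : Prop :=
  ∃ y : Y, ∃ a < ‖y‖, ∀ z : Y, ∀ b < ‖z‖,
    dualSlice (z : E) b ⊆ dualSlice (y : E) a → (dualSlice (z : E) b ∩ A).Nonempty

variable {Y : Submodule ℝ E}

theorem SomewhereSliceDense.mono {A B : Set (E →L[ℝ] ℝ)} (hA : SomewhereSliceDense Y A)
    (h : A ⊆ B) : SomewhereSliceDense Y B := by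
  obtain ⟨y, a, ha, H⟩ := hA
  exact ⟨y, a, ha, fun z b hb hz => (H z b hb hz).mono (Set.inter_subset_inter_right _ h)⟩

theorem SomewhereSliceDense.of_union {A B : Set (E →L[ℝ] ℝ)}
    (h : SomewhereSliceDense Y (A ∪ B)) :
    SomewhereSliceDense Y A ∨ SomewhereSliceDense Y B := by
  by_contra! hAB
  obtain ⟨hA, hB⟩ := hAB
  obtain ⟨y, a, ha, H⟩ := h
  simp only [SomewhereSliceDense, not_exists, not_and, not_forall] at hA
  obtain ⟨z, b, hb, hz, hzA⟩ := hA y a ha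
  refine hB ⟨z, b, hb, fun v c hc hv => ?_⟩
  obtain ⟨g, hg, hgA | hgB⟩ := H v c hc (hv.trans hz)
  · exact (hzA ⟨g, hv hg, hgA⟩).elim
  · exact ⟨g, hg, hgB⟩

theorem dualSlice_neg (y : E) (a : ℝ) : dualSlice (-y) a = Neg.neg ⁻¹' dualSlice y a := by
  ext g
  simp [dualSlice]

theorem SomewhereSliceDense.neg {A : Set (E →L[ℝ] ℝ)} (hA : SomewhereSliceDense Y A) :
    SomewhereSliceDense Y (Neg.neg ⁻¹' A) := by
  obtain ⟨y, a, ha, H⟩ := hA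
  refine ⟨-y, a, by simpa using ha, fun z b hb hz => ?_⟩
  obtain ⟨g, hg, hgA⟩ := H (-z) b (by simpa using hb) fun g hg => by
    have := @hz (-g) (by simpa [dualSlice_neg] using hg)
    simpa [dualSlice_neg] using this
  exact ⟨-g, by simpa [dualSlice_neg] using hg, by simpa using hgA⟩

/-- The levels `t` which a vector `u` exceeds on a somewhere dense set of functionals. -/
def sliceLevels (Y : Submodule ℝ E) (u : E) : Set ℝ :=
  {t | SomewhereSliceDense Y {g | t < g u}}

theorem le_norm_of_mem_sliceLevels {u : E} {t : ℝ} (ht : t ∈ sliceLevels Y u) : t ≤ ‖u‖ := by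
  obtain ⟨y, a, ha, H⟩ := ht
  obtain ⟨g, hg, hgu⟩ := H y a ha subset_rfl
  calc t ≤ g u := le_of_lt hgu
    _ ≤ ‖g u‖ := le_abs_self _
    _ ≤ 1 * ‖u‖ := g.le_of_opNorm_le hg.1 u
    _ = ‖u‖ := one_mul _

theorem bddAbove_sliceLevels (u : E) : BddAbove (sliceLevels Y u) :=
  ⟨‖u‖, fun _ => le_norm_of_mem_sliceLevels⟩

theorem mem_sliceLevels_of_lt_neg_norm {u : E} {t : ℝ} (ht : t < -‖u‖) :
    t ∈ sliceLevels Y u := by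
  refine ⟨0, -1, by simp, fun z b hb _ => ?_⟩
  obtain ⟨g, hg⟩ := dualSlice_nonempty (y := (z : E)) hb
  refine ⟨g, hg, ?_⟩
  have h : |g u| ≤ 1 * ‖u‖ := g.le_of_opNorm_le hg.1 u
  have := neg_abs_le (g u)
  change t < g u
  linarith

theorem sliceLevels_nonempty (u : E) : (sliceLevels Y u).Nonempty :=
  ⟨-‖u‖ - 1, mem_sliceLevels_of_lt_neg_norm (by linarith)⟩

theorem mem_sliceLevels_coe {y : Y} {t : ℝ} (ht : t < ‖y‖) : t ∈ sliceLevels Y (y : E) := by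
  refine ⟨y, t, ht, fun z b hb hz => ?_⟩
  obtain ⟨g, hg⟩ := dualSlice_nonempty (y := (z : E)) hb
  exact ⟨g, hg, (hz hg).2⟩

theorem sSup_sliceLevels_le_norm (u : E) : sSup (sliceLevels Y u) ≤ ‖u‖ :=
  csSup_le (sliceLevels_nonempty u) fun _ => le_norm_of_mem_sliceLevels

theorem sSup_sliceLevels_coe (y : Y) : sSup (sliceLevels Y (y : E)) = ‖y‖ :=
  le_antisymm (sSup_sliceLevels_le_norm _) <| le_of_forall_lt fun t ht => by
    obtain ⟨s, hts, hs⟩ := exists_between ht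
    exact hts.trans_le (le_csSup (bddAbove_sliceLevels _) (mem_sliceLevels_coe hs))

theorem sSup_sliceLevels_add_le (u v : E) :
    sSup (sliceLevels Y (u + v)) ≤ sSup (sliceLevels Y u) + sSup (sliceLevels Y v) := by
  refine csSup_le (sliceLevels_nonempty _) fun t ht => ?_
  by_contra! h
  set p := sSup (sliceLevels Y u)
  set q := sSup (sliceLevels Y v)
  have hsub : {g : E →L[ℝ] ℝ | t < g (u + v)} ⊆
      {g | p + (t - p - q) / 2 < g u} ∪ {g | q + (t - p - q) / 2 < g v} := by
    intro g hg
    by_contra! hcon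
    simp only [Set.mem_union, Set.mem_ofPred_eq, not_or, not_lt, map_add] at hg hcon
    linarith [hcon.1, hcon.2]
  rcases (SomewhereSliceDense.mono ht hsub).of_union with h' | h'
  · have : _ ≤ p := le_csSup (bddAbove_sliceLevels u) h'
    linarith
  · have : _ ≤ q := le_csSup (bddAbove_sliceLevels v) h'
    linarith

theorem sSup_sliceLevels_smul_le (a : ℝ) (u : E) :
    sSup (sliceLevels Y (a • u)) ≤ |a| * sSup (sliceLevels Y u) := by
  rcases eq_or_ne a 0 with rfl | ha
  · simpa using (sSup_sliceLevels_le_norm (Y := Y) (0 : E))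
  have ha' : 0 < |a| := abs_pos.mpr ha
  refine csSup_le (sliceLevels_nonempty _) fun t ht => ?_
  rw [← div_le_iff₀' ha']
  refine le_csSup (bddAbove_sliceLevels u) ?_
  rcases abs_cases a with ⟨h, _⟩ | ⟨h, _⟩
  · refine SomewhereSliceDense.mono ht fun g hg => ?_
    have hg : t < a * g u := by simpa using hg
    change t / |a| < g u
    rw [div_lt_iff₀' ha', h]
    exact hg
  · refine (SomewhereSliceDense.neg ht).mono fun g hg => ?_
    have hg : t < -(a * g u) := by simpa using hg
    change t / |a| < g u
    rw [div_lt_iff₀' ha', h]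
    linarith

/-- The seminorm on `E` which assigns to `u` its essential supremum over the dual unit ball,
modulo sets of functionals that are nowhere dense with respect to slices defined by `Y`. -/
noncomputable def sliceSeminorm (Y : Submodule ℝ E) : Seminorm ℝ E :=
  Seminorm.ofSMulLE (fun u => sSup (sliceLevels Y u))
    (by simpa using sSup_sliceLevels_coe (0 : Y))
    sSup_sliceLevels_add_le sSup_sliceLevels_smul_le

theorem sliceSeminorm_le_norm (u : E) : sliceSeminorm Y u ≤ ‖u‖ :=
  sSup_sliceLevels_le_norm u

theorem sliceSeminorm_coe (y : Y) : sliceSeminorm Y (y : E) = ‖y‖ :=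
  sSup_sliceLevels_coe y

/-- The sum of the slice seminorm and the quotient seminorm of `E ⧸ Y`. -/
noncomputable def daugavetSeminorm (Y : Submodule ℝ E) : Seminorm ℝ E :=
  sliceSeminorm Y + (normSeminorm ℝ (E ⧸ Y)).comp Y.mkQ

theorem daugavetSeminorm_apply (u : E) :
    daugavetSeminorm Y u = sliceSeminorm Y u + ‖Y.mkQ u‖ := rfl

theorem daugavetSeminorm_coe (y : Y) : daugavetSeminorm Y (y : E) = ‖y‖ := by
  have h : Y.mkQ (y : E) = 0 := (Submodule.Quotient.mk_eq_zero Y).mpr y.2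
  rw [daugavetSeminorm_apply, sliceSeminorm_coe, h, norm_zero, add_zero]

theorem daugavetSeminorm_le (u : E) : daugavetSeminorm Y u ≤ 2 * ‖u‖ := by
  have h₁ := sliceSeminorm_le_norm (Y := Y) u
  have h₂ : ‖Y.mkQ u‖ ≤ ‖u‖ := Submodule.Quotient.norm_mk_le Y u
  rw [daugavetSeminorm_apply]
  linarith

theorem norm_le_daugavetSeminorm (u : E) : ‖u‖ ≤ 2 * daugavetSeminorm Y u := by
  refine le_of_forall_pos_le_add fun ε hε => ?_
  obtain ⟨m, hm, hmlt⟩ := Submodule.Quotient.norm_mk_lt (S := Y) (Y.mkQ u) (half_pos hε)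
  have hy : u - m ∈ Y := (Submodule.Quotient.eq Y).mp hm.symm
  have h₁ := norm_le_norm_sub_add u m
  have h₂ : sliceSeminorm Y (u - m) = ‖u - m‖ := sliceSeminorm_coe ⟨u - m, hy⟩
  have h₃ := map_sub_le_add (sliceSeminorm Y) u m
  have h₄ := sliceSeminorm_le_norm (Y := Y) m
  have h₅ := apply_nonneg (sliceSeminorm Y) u
  rw [daugavetSeminorm_apply]
  linarith

end SlicewiseNorm

section DaugavetCenter

variable {X Y : Type*} [NormedAddCommGroup X] [NormedSpace ℝ X]
  [NormedAddCommGroup Y] [NormedSpace ℝ Y]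

theorem ContinuousLinearMap.exists_norm_le_one_lt_norm (T : X →L[ℝ] Y) {r : ℝ} (hr : r < ‖T‖) :
    ∃ x, ‖x‖ ≤ 1 ∧ r < ‖T x‖ := by
  by_cases hr₀ : r < 0
  · exact ⟨0, by simp, by simpa using hr₀⟩
  · obtain ⟨x, hx, hrx⟩ := T.exists_lt_apply_of_lt_opNorm hr
    exact ⟨x, hx.le, hrx⟩

theorem IsDaugavetCenter.exists_lt_of_ne_zero {G : X →L[ℝ] Y} (hG : IsDaugavetCenter G)
    {x' : X →L[ℝ] ℝ} (hx' : x' ≠ 0) {y : Y} (hy : y ≠ 0) {δ : ℝ} (hδ : 0 < δ) :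
    ∃ x, ‖x‖ ≤ 1 ∧ ‖x'‖ - δ < x' x ∧ ‖y‖ + ‖G‖ - δ < ‖y + G x‖ := by
  have hn : 0 < ‖x'‖ := norm_pos_iff.mpr hx'
  have hm : 0 < ‖y‖ := norm_pos_iff.mpr hy
  set η := min (δ / 2) (δ * ‖y‖ / ‖x'‖)
  have hη₀ : 0 < η := by positivity
  have hη₁ : η ≤ δ / 2 := min_le_left _ _
  have hη₂ : η * ‖x'‖ ≤ δ * ‖y‖ := (le_div_iff₀ hn).mp (min_le_right _ _)
  have hnorm : ‖G + x'.smulRight (‖x'‖⁻¹ • y)‖ = ‖G‖ + ‖y‖ := by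
    rw [hG, ContinuousLinearMap.norm_smulRight_apply, norm_smul, norm_inv, norm_norm,
      mul_inv_cancel_left₀ hn.ne']
  obtain ⟨x, hx, hlt, hpos⟩ : ∃ x, ‖x‖ ≤ 1 ∧
      ‖G‖ + ‖y‖ - η < ‖G x + x' x • ‖x'‖⁻¹ • y‖ ∧ 0 ≤ x' x := by
    obtain ⟨x, hx, hlt⟩ := (G + x'.smulRight (‖x'‖⁻¹ • y)).exists_norm_le_one_lt_norm
      (r := ‖G‖ + ‖y‖ - η) (by rw [hnorm]; linarith)
    rcases le_total 0 (x' x) with h | h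
    · exact ⟨x, hx, hlt, h⟩
    · refine ⟨-x, by simpa using hx, ?_, by simpa using h⟩
      have hneg : G (-x) + x' (-x) • ‖x'‖⁻¹ • y = -((G + x'.smulRight (‖x'‖⁻¹ • y)) x) := by
        simp [add_comm]
      rwa [hneg, norm_neg]
  have hGx : ‖G x‖ ≤ ‖G‖ := G.unit_le_opNorm x hx
  have hx'x : x' x ≤ ‖x'‖ := (le_abs_self _).trans (x'.unit_le_opNorm x hx)
  set s := x' x * ‖x'‖⁻¹ with hs
  have hs₀ : 0 ≤ s := by positivity
  have hs₁ : s ≤ 1 := by rw [hs, ← div_eq_mul_inv]; exact (div_le_one hn).mpr hx'x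
  have hsx : s * ‖x'‖ = x' x := by rw [hs, inv_mul_cancel_right₀ hn.ne']
  rw [smul_smul, ← hs] at hlt
  have h₁ : ‖G x + s • y‖ ≤ ‖G x‖ + s * ‖y‖ := by
    simpa [norm_smul, abs_of_nonneg hs₀] using norm_add_le (G x) (s • y)
  have h₂ : (1 - s) * ‖y‖ < η := by linarith
  refine ⟨x, hx, ?_, ?_⟩
  · have h₃ : (1 - s) * ‖y‖ * ‖x'‖ < δ * ‖y‖ :=
      (mul_lt_mul_of_pos_right h₂ hn).trans_le hη₂
    have h₄ : (1 - s) * ‖x'‖ < δ := by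
      refine lt_of_mul_lt_mul_right ?_ hm.le
      linarith
    linarith
  · have h₅ : G x + s • y = (y + G x) - (1 - s) • y := by module
    have h₆ : ‖G x + s • y‖ ≤ ‖y + G x‖ + (1 - s) * ‖y‖ := by
      rw [h₅]
      simpa [norm_smul, abs_of_nonneg (sub_nonneg.mpr hs₁)] using
        norm_sub_le (y + G x) ((1 - s) • y)
    linarith

theorem IsDaugavetCenter.exists_lt {G : X →L[ℝ] Y} (hG : IsDaugavetCenter G)
    {x' : X →L[ℝ] ℝ} (hx' : x' ≠ 0) (y : Y) {δ : ℝ} (hδ : 0 < δ) :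
    ∃ x, ‖x‖ ≤ 1 ∧ ‖x'‖ - δ < x' x ∧ ‖y‖ + ‖G‖ - δ < ‖y + G x‖ := by
  rcases ne_or_eq y 0 with hy | rfl
  · exact hG.exists_lt_of_ne_zero hx' hy hδ
  by_cases hY : ∃ z : Y, z ≠ 0
  · obtain ⟨z, hz⟩ := hY
    obtain ⟨x, hx, h₁, h₂⟩ := hG.exists_lt_of_ne_zero hx' hz hδ
    refine ⟨x, hx, h₁, ?_⟩
    have := norm_add_le z (G x)
    simp only [norm_zero, zero_add]
    linarith
  · push Not at hY
    obtain rfl : G = 0 := by ext x; exact hY _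
    obtain ⟨x, hx, hlt⟩ := x'.exists_norm_le_one_lt_norm (sub_lt_self ‖x'‖ hδ)
    rcases le_total 0 (x' x) with h | h
    · exact ⟨x, hx, by simpa [abs_of_nonneg h] using hlt, by simpa using hδ⟩
    · exact ⟨-x, by simpa using hx, by simpa [abs_of_nonpos h] using hlt, by simpa using hδ⟩

end DaugavetCenter

section Renorming

variable {X E : Type*} [NormedAddCommGroup X] [NormedSpace ℝ X]
  [NormedAddCommGroup E] [NormedSpace ℝ E]

theorem IsDaugavetCenter.exists_le_sliceSeminorm {Y : Submodule ℝ E} {G : X →L[ℝ] Y}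
    (hG : IsDaugavetCenter G) {x' : X →L[ℝ] ℝ} (hx' : x' ≠ 0) (u : E) {ε : ℝ} (hε : 0 < ε) :
    ∃ x, ‖x‖ ≤ 1 ∧ ‖x'‖ - ε < x' x ∧
      sliceSeminorm Y u + ‖G‖ - ε ≤ sliceSeminorm Y (u + G x) := by
  obtain ⟨t, ⟨y, a, ha, H⟩, hlt⟩ := exists_lt_of_lt_csSup (sliceLevels_nonempty (Y := Y) u)
    (sub_lt_self (sliceSeminorm Y u) (half_pos hε))
  set δ := min (ε / 2) (‖y‖ - a)
  have hδ₀ : 0 < δ := lt_min (half_pos hε) (sub_pos.mpr ha)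
  have hδ₁ : δ ≤ ε / 2 := min_le_left _ _
  have hδ₂ : δ ≤ ‖y‖ - a := min_le_right _ _
  obtain ⟨x, hx, hx'x, hyx⟩ := hG.exists_lt hx' y hδ₀
  have bound : ∀ g : E →L[ℝ] ℝ, ‖g‖ ≤ 1 → ∀ z : Y, g z ≤ ‖z‖ := fun g hg z => by
    have := (le_abs_self _).trans (g.le_of_opNorm_le hg z)
    simpa using this
  have hGx : ‖G x‖ ≤ ‖G‖ := G.unit_le_opNorm x hx
  have hslice : ∀ g ∈ dualSlice ((y + G x : Y) : E) (‖y‖ + ‖G‖ - δ),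
      a < g y ∧ ‖G‖ - δ < g (G x) := fun g hg => by
    have h₁ := bound g hg.1 y
    have h₂ := bound g hg.1 (G x)
    have h₃ : ‖y‖ + ‖G‖ - δ < g y + g (G x) := by simpa using hg.2
    constructor <;> linarith
  refine ⟨x, hx, by linarith, ?_⟩
  have hmem : t + (‖G‖ - δ) ∈ sliceLevels Y (u + G x) := by
    refine ⟨y + G x, ‖y‖ + ‖G‖ - δ, hyx, fun z b hb hz => ?_⟩
    obtain ⟨g, hg, hgt⟩ := H z b hb (hz.trans fun g hg => ⟨hg.1, (hslice g hg).1⟩)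
    refine ⟨g, hg, ?_⟩
    change t + (‖G‖ - δ) < g (u + G x)
    rw [map_add]
    exact add_lt_add hgt (hslice g (hz hg)).2
  have : _ ≤ sliceSeminorm Y (u + G x) := le_csSup (bddAbove_sliceLevels _) hmem
  linarith

theorem IsDaugavetCenter.exists_le_daugavetSeminorm {Y : Submodule ℝ E} {G : X →L[ℝ] Y}
    (hG : IsDaugavetCenter G) {x' : X →L[ℝ] ℝ} (hx' : x' ≠ 0) (u : E) {ε : ℝ} (hε : 0 < ε) :
    ∃ x, ‖x‖ ≤ 1 ∧ ‖x'‖ - ε < x' x ∧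
      daugavetSeminorm Y u + ‖G‖ - ε ≤ daugavetSeminorm Y (u + G x) := by
  obtain ⟨x, hx, hx'x, h⟩ := hG.exists_le_sliceSeminorm hx' u hε
  refine ⟨x, hx, hx'x, ?_⟩
  have hq : Y.mkQ (u + G x) = Y.mkQ u := by simp
  rw [daugavetSeminorm_apply, daugavetSeminorm_apply, hq]
  linarith

theorem opNormWith_le {N : E → ℝ} {T : X →L[ℝ] E} {C : ℝ}
    (h : ∀ x, ‖x‖ ≤ 1 → N (T x) ≤ C) : opNormWith N T ≤ C := by
  refine csSup_le ⟨_, 0, by simp, rfl⟩ ?_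
  rintro _ ⟨x, hx, rfl⟩
  exact h x hx

theorem le_opNormWith {N : E → ℝ} {C : ℝ} (hC : 0 ≤ C) (hN : ∀ u, N u ≤ C * ‖u‖)
    (T : X →L[ℝ] E) {x : X} (hx : ‖x‖ ≤ 1) : N (T x) ≤ opNormWith N T := by
  refine le_csSup ⟨C * ‖T‖, ?_⟩ ⟨x, hx, rfl⟩
  rintro _ ⟨z, hz, rfl⟩
  exact (hN _).trans (mul_le_mul_of_nonneg_left (T.unit_le_opNorm z hz) hC)

theorem opNormWith_add_le (N : Seminorm ℝ E) {C : ℝ} (hC : 0 ≤ C) (hN : ∀ u, N u ≤ C * ‖u‖)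
    (S T : X →L[ℝ] E) : opNormWith N (S + T) ≤ opNormWith N S + opNormWith N T :=
  opNormWith_le fun _ hx => (map_add_le_add N _ _).trans
    (add_le_add (le_opNormWith hC hN S hx) (le_opNormWith hC hN T hx))

theorem IsDaugavetCenter.opNormWith_add {Y : Submodule ℝ E} {G : X →L[ℝ] Y}
    (hG : IsDaugavetCenter G) (x' : X →L[ℝ] ℝ) (w : E) :
    opNormWith (daugavetSeminorm Y) (Y.subtypeL.comp G + x'.smulRight w) =
      opNormWith (daugavetSeminorm Y) (Y.subtypeL.comp G) +
        opNormWith (daugavetSeminorm Y) (x'.smulRight w) := by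
  set N := daugavetSeminorm Y
  refine le_antisymm (opNormWith_add_le N zero_le_two daugavetSeminorm_le _ _) ?_
  have hNw : 0 ≤ N w := apply_nonneg N w
  have hGN : opNormWith N (Y.subtypeL.comp G) ≤ ‖G‖ := opNormWith_le fun x hx =>
    (daugavetSeminorm_coe (G x)).trans_le (G.unit_le_opNorm x hx)
  have hTN : opNormWith N (x'.smulRight w) ≤ ‖x'‖ * N w := opNormWith_le fun x hx => by
    simpa [map_smul_eq_mul] using mul_le_mul_of_nonneg_right (x'.unit_le_opNorm x hx) hNw
  rcases eq_or_ne x' 0 with rfl | hx'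
  · have h₀ : (0 : X →L[ℝ] ℝ).smulRight w = 0 := by ext; simp
    rw [h₀, norm_zero, zero_mul] at hTN
    rw [h₀, add_zero]
    linarith
  refine (add_le_add hGN hTN).trans (le_of_forall_pos_le_add fun ε hε => ?_)
  have hw : 0 < 1 + N w := by linarith
  obtain ⟨x, hx, hx'x, h⟩ := hG.exists_le_daugavetSeminorm hx' (‖x'‖ • w) (div_pos hε hw)
  have hle : x' x ≤ ‖x'‖ := (le_abs_self _).trans (x'.unit_le_opNorm x hx)
  have h₁ : N (‖x'‖ • w) = ‖x'‖ * N w := by simp [map_smul_eq_mul]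
  have h₂ : N (‖x'‖ • w + G x) ≤ N (G x + x' x • w) + (‖x'‖ - x' x) * N w := by
    have h₃ : ‖x'‖ • w + (G x : E) = (G x + x' x • w) + (‖x'‖ - x' x) • w := by module
    rw [h₃]
    refine (map_add_le_add N _ _).trans_eq ?_
    rw [map_smul_eq_mul N, Real.norm_of_nonneg (sub_nonneg.mpr hle)]
  have h₄ : (‖x'‖ - x' x) * N w ≤ ε / (1 + N w) * N w :=
    mul_le_mul_of_nonneg_right (by linarith) hNw
  have h₅ : ε / (1 + N w) + ε / (1 + N w) * N w = ε := by field_simp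
  have h₆ : N (G x + x' x • w) ≤ opNormWith N (Y.subtypeL.comp G + x'.smulRight w) :=
    le_opNormWith zero_le_two daugavetSeminorm_le (Y.subtypeL.comp G + x'.smulRight w) hx
  linarith

end Renorming

/-- If `G : X → Y` is a Daugavet center and `Y` is a closed subspace of a Banach space `E`,
then `E` admits an equivalent norm `N` coinciding with the original norm on `Y` such that
`J ∘ G : X → (E, N)` is a Daugavet center, where `J : Y → E` is the inclusion. -/
theorem stmt0 {X E : Type*} [NormedAddCommGroup X] [NormedSpace ℝ X] [CompleteSpace X]
    [NormedAddCommGroup E] [NormedSpace ℝ E] [CompleteSpace E]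
    (Y : Submodule ℝ E) (hY : IsClosed (Y : Set E))
    (G : X →L[ℝ] Y) (hDC : IsDaugavetCenter G) :
    ∃ N : E → ℝ,
      -- `N` is a norm on `E`:
      (∀ u v : E, N (u + v) ≤ N u + N v) ∧
      (∀ (a : ℝ) (u : E), N (a • u) = |a| * N u) ∧
      (∀ u : E, N u = 0 ↔ u = 0) ∧
      -- `N` is equivalent to the original norm of `E`:
      (∃ c : ℝ, 0 < c ∧ ∃ C : ℝ, 0 < C ∧ ∀ u : E, c * ‖u‖ ≤ N u ∧ N u ≤ C * ‖u‖) ∧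
      -- `N` coincides with the original norm on `Y`:
      (∀ y : Y, N (y : E) = ‖y‖) ∧
      -- `J ∘ G : X → (E, N)` is a Daugavet center (operator norms taken w.r.t. `N`):
      (∀ (x' : X →L[ℝ] ℝ) (w : E),
        opNormWith N ((Y.subtypeL.comp G) + x'.smulRight w)
          = opNormWith N (Y.subtypeL.comp G) + opNormWith N (x'.smulRight w)) := by
  refine ⟨daugavetSeminorm Y, map_add_le_add _, fun a u => map_smul_eq_mul _ a u, fun u => ?_,
    ⟨1 / 2, by norm_num, 2, by norm_num, fun u => ⟨?_, daugavetSeminorm_le u⟩⟩,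
    daugavetSeminorm_coe, hDC.opNormWith_add⟩
  · refine ⟨fun h => ?_, fun h => by rw [h, map_zero]⟩
    have := norm_le_daugavetSeminorm (Y := Y) u
    rw [h, mul_zero] at this
    exact norm_le_zero_iff.mp this
  · linarith [norm_le_daugavetSeminorm (Y := Y) u]
end

section
/- Let X and Y be real Banach spaces and let G : X → Y be a bounded linear operator with ‖G‖ = 1. Then G is a Daugavet center if and only if for every y₀ in the unit sphere S_Y of Y, every x₀* in the unit sphere S_{X*} of X*, and every ε > 0, there exists x in the closed unit ball B_X of X with x₀*(x) ≥ 1 − ε and ‖Gx + y₀‖ > 2 − ε. -/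
/-- If `u`, `v` in the unit ball satisfy `‖u + v‖ ≥ 2 - δ`, then the triangle inequality is almost
an equality for `u` and every nonnegative multiple of `v`. -/
theorem one_add_sub_le_norm_add_smul {E : Type*} [NormedAddCommGroup E] [NormedSpace ℝ E]
    {u v : E} {t δ : ℝ} (hu : ‖u‖ ≤ 1) (hv : ‖v‖ ≤ 1) (ht : 0 ≤ t) (hδ : 0 ≤ δ)
    (h : 2 - δ ≤ ‖u + v‖) : 1 + t - (1 + t) * δ ≤ ‖u + t • v‖ := by
  rcases le_total t 1 with h1 | h1
  · have h2 : ‖u + v‖ ≤ ‖u + t • v‖ + (1 - t) * ‖v‖ := by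
      calc ‖u + v‖ = ‖(u + t • v) + (1 - t) • v‖ := by congr 1; module
        _ ≤ ‖u + t • v‖ + ‖(1 - t) • v‖ := norm_add_le _ _
        _ = _ := by rw [norm_smul, Real.norm_of_nonneg (sub_nonneg.2 h1)]
    nlinarith
  · have h2 : t * ‖u + v‖ ≤ ‖u + t • v‖ + (t - 1) * ‖u‖ := by
      calc t * ‖u + v‖ = ‖t • (u + v)‖ := by rw [norm_smul, Real.norm_of_nonneg ht]
        _ = ‖(u + t • v) + (t - 1) • u‖ := by congr 1; module
        _ ≤ ‖u + t • v‖ + ‖(t - 1) • u‖ := norm_add_le _ _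
        _ = _ := by rw [norm_smul, Real.norm_of_nonneg (sub_nonneg.2 h1)]
    nlinarith

/-- An operator whose norm exceeds `r` is larger than `r` in norm at some point of the unit ball
where a given functional is nonnegative. -/
theorem exists_nonneg_apply_of_lt_opNorm {X Y : Type*} [NormedAddCommGroup X] [NormedSpace ℝ X]
    [NormedAddCommGroup Y] [NormedSpace ℝ Y] (S : X →L[ℝ] Y) (f : X →L[ℝ] ℝ) {r : ℝ}
    (hr : r < ‖S‖) : ∃ x, ‖x‖ ≤ 1 ∧ 0 ≤ f x ∧ r < ‖S x‖ := by
  obtain ⟨x, hx, hrx⟩ := S.exists_lt_apply_of_lt_opNorm hr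
  rcases le_total 0 (f x) with h | h
  · exact ⟨x, hx.le, h, hrx⟩
  · exact ⟨-x, by simpa using hx.le, by simpa using h, by simpa using hrx⟩

theorem stmt1 {X Y : Type*} [NormedAddCommGroup X] [NormedSpace ℝ X] [CompleteSpace X]
    [NormedAddCommGroup Y] [NormedSpace ℝ Y] [CompleteSpace Y]
    (G : X →L[ℝ] Y) (hG : ‖G‖ = 1) :
    IsDaugavetCenter G ↔
      ∀ y₀ : Y, ‖y₀‖ = 1 → ∀ x₀' : X →L[ℝ] ℝ, ‖x₀'‖ = 1 → ∀ ε : ℝ, 0 < ε →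
        ∃ x : X, ‖x‖ ≤ 1 ∧ x₀' x ≥ 1 - ε ∧ ‖G x + y₀‖ > 2 - ε := by
  have hGx : ∀ x, ‖x‖ ≤ 1 → ‖G x‖ ≤ 1 := fun x hx => by
    simpa [hG] using G.le_opNorm_of_le hx
  constructor
  · intro h y₀ hy x₀' hx' ε hε
    have hlt : 2 - ε / 2 < ‖G + x₀'.smulRight y₀‖ := by
      rw [h x₀' y₀, ContinuousLinearMap.norm_smulRight_apply, hG, hx', hy]
      linarith
    obtain ⟨x, hx, h0, hr⟩ := exists_nonneg_apply_of_lt_opNorm _ x₀' hlt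
    have h1 : x₀' x ≤ 1 := (le_abs_self _).trans (by simpa [hx'] using x₀'.le_opNorm_of_le hx)
    simp only [add_apply, ContinuousLinearMap.smulRight_apply] at hr
    have h2 : ‖G x + x₀' x • y₀‖ ≤ ‖G x‖ + x₀' x := by
      simpa [norm_smul, hy, abs_of_nonneg h0] using norm_add_le (G x) (x₀' x • y₀)
    have h3 : ‖G x + x₀' x • y₀‖ ≤ ‖G x + y₀‖ + (1 - x₀' x) := by
      calc ‖G x + x₀' x • y₀‖ = ‖(G x + y₀) - (1 - x₀' x) • y₀‖ := by congr 1; module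
        _ ≤ ‖G x + y₀‖ + ‖(1 - x₀' x) • y₀‖ := norm_sub_le _ _
        _ = _ := by rw [norm_smul, Real.norm_of_nonneg (sub_nonneg.2 h1), hy, mul_one]
    have h4 := hGx x hx
    exact ⟨x, hx, by linarith, by linarith⟩
  · intro h x' y
    rcases eq_or_ne x' 0 with rfl | hx'
    · simp
    rcases eq_or_ne y 0 with rfl | hy
    · simp
    refine le_antisymm (norm_add_le _ _) (le_of_forall_pos_le_add fun ε hε => ?_)
    rw [ContinuousLinearMap.norm_smulRight_apply, hG]
    have hx'0 := norm_pos_iff.2 hx'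
    have hy0 := norm_pos_iff.2 hy
    set t := ‖x'‖ * ‖y‖ with ht
    have ht0 : 0 < t := mul_pos hx'0 hy0
    obtain ⟨δ, hδ, hδε⟩ : ∃ δ : ℝ, 0 < δ ∧ (1 + 2 * t) * δ = ε :=
      ⟨ε / (1 + 2 * t), by positivity, by field_simp⟩
    have hv : ‖‖y‖⁻¹ • y‖ = 1 := by simp [norm_smul, hy0.ne']
    have hf : ‖‖x'‖⁻¹ • x'‖ = 1 := by simp [norm_smul, hx'0.ne']
    obtain ⟨x, hx, hfx, hG2⟩ := h _ hv _ hf δ hδ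
    have h1 := one_add_sub_le_norm_add_smul (hGx x hx) hv.le ht0.le hδ.le hG2.le
    set s := (‖x'‖⁻¹ • x') x with hs
    have hs1 : s ≤ 1 :=
      (le_abs_self _).trans (((‖x'‖⁻¹ • x').le_opNorm_of_le hx).trans (by rw [hf, mul_one]))
    have hT : x' x • y = (t * s) • ‖y‖⁻¹ • y := by
      rw [smul_smul, hs, ht, smul_apply, smul_eq_mul]
      congr 1
      field_simp
    have h2 : ‖G x + t • ‖y‖⁻¹ • y‖ ≤ ‖G x + x' x • y‖ + t * (1 - s) := by
      calc ‖G x + t • ‖y‖⁻¹ • y‖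
          = ‖(G x + x' x • y) + (t * (1 - s)) • ‖y‖⁻¹ • y‖ := by rw [hT]; congr 1; module
        _ ≤ ‖G x + x' x • y‖ + ‖(t * (1 - s)) • ‖y‖⁻¹ • y‖ := norm_add_le _ _
        _ = _ := by
          rw [norm_smul, hv, Real.norm_of_nonneg (mul_nonneg ht0.le (sub_nonneg.2 hs1)), mul_one]
    have h3 : ‖G x + x' x • y‖ ≤ ‖G + x'.smulRight y‖ := by
      simpa using (G + x'.smulRight y).le_opNorm_of_le hx
    nlinarith
end

section
/- Let X and Y be real Banach spaces and let G : X → Y be a bounded linear operator with ‖G‖ = 1. Then G is a Daugavet center if and only if for every y₀ in the unit sphere S_Y of Y, every x₀* in the unit sphere S_{X*} of X*, and every ε₀ > 0, there exist x₁* ∈ S_{X*} and ε₁ > 0 such that the slice S(x₁*, ε₁) is contained in the slice S(x₀*, ε₀) and ‖Gx + y₀‖ > 2 − ε₀ for every x ∈ S(x₁*, ε₁). -/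
/-- The slice `S(x*, ε) = {x ∈ B_X : x*(x) ≥ 1 - ε}` of the closed unit ball. -/
def ballSlice {X : Type*} [NormedAddCommGroup X] [NormedSpace ℝ X]
    (x' : X →L[ℝ] ℝ) (ε : ℝ) : Set X :=
  {x : X | ‖x‖ ≤ 1 ∧ x' x ≥ 1 - ε}

/-- An operator of norm greater than `r` almost attains its norm on the closed unit ball. -/
theorem exists_norm_le_one_lt_norm_apply {X Y : Type*} [NormedAddCommGroup X] [NormedSpace ℝ X]
    [NormedAddCommGroup Y] [NormedSpace ℝ Y] (T : X →L[ℝ] Y) {r : ℝ} (hr : r < ‖T‖) :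
    ∃ x : X, ‖x‖ ≤ 1 ∧ r < ‖T x‖ := by
  obtain ⟨x, hx, hrx⟩ := T.exists_lt_apply_of_lt_opNorm hr
  exact ⟨x, hx.le, hrx⟩

theorem apply_le_one_of_norm_le_one {X : Type*} [NormedAddCommGroup X] [NormedSpace ℝ X]
    {f : X →L[ℝ] ℝ} {x : X} (hf : ‖f‖ ≤ 1) (hx : ‖x‖ ≤ 1) : f x ≤ 1 :=
  (le_abs_self _).trans (f.le_of_opNorm_le_of_le hf hx |>.trans_eq (one_mul 1))

theorem ballSlice_nonempty {X : Type*} [NormedAddCommGroup X] [NormedSpace ℝ X]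
    {f : X →L[ℝ] ℝ} (hf : ‖f‖ = 1) {ε : ℝ} (hε : 0 < ε) : (ballSlice f ε).Nonempty := by
  obtain ⟨x, hx, hfx⟩ := exists_norm_le_one_lt_norm_apply f (r := 1 - ε) (by linarith)
  rw [Real.norm_eq_abs] at hfx
  rcases abs_choice (f x) with h | h
  · exact ⟨x, hx, by linarith⟩
  · exact ⟨-x, by rwa [norm_neg], by rw [map_neg]; linarith⟩

/-- If `‖G + f ⊗ y‖` is almost `2`, some `g` in the dual unit ball has `g y` almost `1` and
`‖g ∘ (G + f ⊗ y)‖` almost `2`. -/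
theorem exists_functional_of_lt_norm_add_smulRight {X Y : Type*} [NormedAddCommGroup X]
    [NormedSpace ℝ X] [NormedAddCommGroup Y] [NormedSpace ℝ Y] {G : X →L[ℝ] Y} (hG : ‖G‖ ≤ 1)
    {f : X →L[ℝ] ℝ} (hf : ‖f‖ ≤ 1) {y : Y} {δ : ℝ} (h : 2 - δ < ‖G + f.smulRight y‖) :
    ∃ g : Y →L[ℝ] ℝ, ‖g‖ ≤ 1 ∧ 1 - δ < g y ∧ 2 - δ < ‖g.comp (G + f.smulRight y)‖ := by
  obtain ⟨x, hx, hxT⟩ := exists_norm_le_one_lt_norm_apply _ h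
  obtain ⟨g, hg, hgx⟩ := exists_dual_vector'' ℝ ((G + f.smulRight y) x)
  replace hgx : g ((G + f.smulRight y) x) = ‖(G + f.smulRight y) x‖ := hgx
  have hGx : ‖G x‖ ≤ 1 := (G.le_of_opNorm_le_of_le hG hx).trans_eq (one_mul 1)
  have hfx : |f x| ≤ 1 := (f.le_of_opNorm_le_of_le hf hx).trans_eq (one_mul 1)
  have hgG := apply_le_one_of_norm_le_one hg hGx
  have hsum : g ((G + f.smulRight y) x) = g (G x) + f x * g y := by simp
  have hgy : 1 - δ < |g y| := by
    have h1 : f x * g y ≤ |f x| * |g y| := (le_abs_self _).trans_eq (abs_mul _ _)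
    have h2 : |f x| * |g y| ≤ |g y| := mul_le_of_le_one_left (abs_nonneg _) hfx
    linarith
  have hnorm : 2 - δ < ‖g.comp (G + f.smulRight y)‖ := by
    have h1 : g ((G + f.smulRight y) x) ≤ ‖g.comp (G + f.smulRight y)‖ :=
      (le_abs_self _).trans ((g.comp (G + f.smulRight y)).unit_le_opNorm x hx)
    linarith
  rcases abs_choice (g y) with h' | h'
  · exact ⟨g, hg, h' ▸ hgy, hnorm⟩
  · exact ⟨-g, by rwa [norm_neg], by simpa [h'] using hgy,
      by rwa [ContinuousLinearMap.neg_comp, norm_neg]⟩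

theorem IsDaugavetCenter.exists_ballSlice_subset {X Y : Type*} [NormedAddCommGroup X]
    [NormedSpace ℝ X] [NormedAddCommGroup Y] [NormedSpace ℝ Y] {G : X →L[ℝ] Y}
    (h : IsDaugavetCenter G) (hG : ‖G‖ = 1) {y : Y} (hy : ‖y‖ = 1) {f : X →L[ℝ] ℝ}
    (hf : ‖f‖ = 1) {ε : ℝ} (hε : 0 < ε) :
    ∃ f₁ : X →L[ℝ] ℝ, ‖f₁‖ = 1 ∧ ∃ ε₁ : ℝ, 0 < ε₁ ∧ ballSlice f₁ ε₁ ⊆ ballSlice f ε ∧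
      ∀ x ∈ ballSlice f₁ ε₁, ‖G x + y‖ > 2 - ε := by
  obtain ⟨δ, hδ, hδε, hδ1⟩ : ∃ δ : ℝ, 0 < δ ∧ 5 * δ ≤ ε ∧ 5 * δ ≤ 1 :=
    ⟨min ε 1 / 5, by positivity, by linarith [min_le_left ε 1], by linarith [min_le_right ε 1]⟩
  have hT : 2 - δ < ‖G + f.smulRight y‖ := by
    rw [h f y, ContinuousLinearMap.norm_smulRight_apply, hG, hf, hy]
    linarith
  obtain ⟨g, hg, hgy, hN⟩ := exists_functional_of_lt_norm_add_smulRight hG.le hf.le hT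
  set φ := g.comp (G + f.smulRight y) with hφ
  have hφ0 : 0 < ‖φ‖ := by linarith
  have key : ∀ x ∈ ballSlice (‖φ‖⁻¹ • φ) δ, 1 - 3 * δ ≤ f x ∧ 1 - 3 * δ ≤ g (G x) := by
    rintro x ⟨hx, hφx⟩
    have hφx' : ‖φ‖ * (1 - δ) ≤ φ x := by
      have h1 : 1 - δ ≤ ‖φ‖⁻¹ * φ x := hφx
      rwa [le_inv_mul_iff₀ hφ0] at h1
    have hsum : φ x = g (G x) + f x * g y := by simp [hφ]
    have hlow : 2 - 3 * δ ≤ φ x := by nlinarith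
    have hgG : g (G x) ≤ 1 := apply_le_one_of_norm_le_one hg
      ((G.le_of_opNorm_le_of_le hG.le hx).trans_eq (one_mul 1))
    have hfx := apply_le_one_of_norm_le_one hf.le hx
    have hgy1 := apply_le_one_of_norm_le_one hg hy.le
    have hfx0 : 0 < f x := pos_of_mul_pos_left (by linarith : 0 < f x * g y) (by linarith)
    constructor <;> nlinarith
  refine ⟨‖φ‖⁻¹ • φ, by rw [norm_smul, norm_inv, norm_norm, inv_mul_cancel₀ hφ0.ne'],
    δ, hδ, fun x hx => ⟨hx.1, by linarith [(key x hx).1]⟩, fun x hx => ?_⟩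
  have h1 : g (G x + y) ≤ ‖G x + y‖ := (le_abs_self _).trans
    ((g.le_of_opNorm_le hg _).trans_eq (one_mul _))
  rw [map_add] at h1
  linarith [(key x hx).2]

/-- Vectors of the unit ball whose sum is almost of norm `2` are almost normed by a common
functional. -/
theorem exists_functional_of_lt_norm_add {Y : Type*} [NormedAddCommGroup Y] [NormedSpace ℝ Y]
    {a b : Y} (ha : ‖a‖ ≤ 1) (hb : ‖b‖ ≤ 1) {ε : ℝ} (h : 2 - ε < ‖a + b‖) :
    ∃ g : Y →L[ℝ] ℝ, ‖g‖ ≤ 1 ∧ 1 - ε < g a ∧ 1 - ε < g b := by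
  obtain ⟨g, hg, hgab⟩ := exists_dual_vector'' ℝ (a + b)
  replace hgab : g (a + b) = ‖a + b‖ := hgab
  rw [map_add] at hgab
  have h1 := apply_le_one_of_norm_le_one hg ha
  have h2 := apply_le_one_of_norm_le_one hg hb
  exact ⟨g, hg, by linarith, by linarith⟩

theorem le_norm_add_smulRight {X Y : Type*} [NormedAddCommGroup X] [NormedSpace ℝ X]
    [NormedAddCommGroup Y] [NormedSpace ℝ Y] {G : X →L[ℝ] Y} (hG : ‖G‖ ≤ 1) {f : X →L[ℝ] ℝ}
    {y : Y} (hy : ‖y‖ ≤ 1) {x : X} {ε t : ℝ} (hε : 0 ≤ ε) (hε1 : ε ≤ 1) (ht : 0 ≤ t)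
    (hx : x ∈ ballSlice f ε) (h : 2 - ε < ‖G x + y‖) :
    (1 + t) * (1 - 2 * ε) ≤ ‖G + t • f.smulRight y‖ := by
  obtain ⟨g, hg, hgG, hgy⟩ := exists_functional_of_lt_norm_add
    ((G.le_of_opNorm_le_of_le hG hx.1).trans_eq (one_mul 1)) hy h
  have hfx : 1 - ε ≤ f x := hx.2
  have hprod : (1 - ε) * (1 - ε) ≤ f x * g y :=
    mul_le_mul hfx hgy.le (by linarith) (by linarith)
  have hle : g ((G + t • f.smulRight y) x) ≤ ‖G + t • f.smulRight y‖ := (le_abs_self _).trans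
    ((g.le_of_opNorm_le_of_le hg ((G + t • f.smulRight y).unit_le_opNorm x hx.1)).trans_eq
      (one_mul _))
  have hsum : g ((G + t • f.smulRight y) x) = g (G x) + t * (f x * g y) := by simp
  have h2 : t * (1 - 2 * ε) ≤ t * (f x * g y) :=
    mul_le_mul_of_nonneg_left (by nlinarith) ht
  linarith

theorem stmt2 {X Y : Type*} [NormedAddCommGroup X] [NormedSpace ℝ X] [CompleteSpace X]
    [NormedAddCommGroup Y] [NormedSpace ℝ Y] [CompleteSpace Y]
    (G : X →L[ℝ] Y) (hG : ‖G‖ = 1) :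
    IsDaugavetCenter G ↔
      ∀ y₀ : Y, ‖y₀‖ = 1 → ∀ x₀' : X →L[ℝ] ℝ, ‖x₀'‖ = 1 → ∀ ε₀ : ℝ, 0 < ε₀ →
        ∃ x₁' : X →L[ℝ] ℝ, ‖x₁'‖ = 1 ∧ ∃ ε₁ : ℝ, 0 < ε₁ ∧
          ballSlice x₁' ε₁ ⊆ ballSlice x₀' ε₀ ∧
          ∀ x ∈ ballSlice x₁' ε₁, ‖G x + y₀‖ > 2 - ε₀ := by
  refine ⟨fun h y hy f hf ε hε => h.exists_ballSlice_subset hG hy hf hε, fun h f y => ?_⟩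
  refine le_antisymm (norm_add_le _ _) ?_
  rw [ContinuousLinearMap.norm_smulRight_apply, hG]
  rcases eq_or_ne f 0 with rfl | hf
  · simp [hG]
  rcases eq_or_ne y 0 with rfl | hy
  · simp [hG]
  have hf0 := norm_pos_iff.2 hf
  have hy0 := norm_pos_iff.2 hy
  set t := ‖f‖ * ‖y‖ with ht
  have ht0 : 0 < t := mul_pos hf0 hy0
  have hT : f.smulRight y = t • (‖f‖⁻¹ • f).smulRight (‖y‖⁻¹ • y) := by
    ext x
    simp only [ContinuousLinearMap.smulRight_apply, smul_apply, smul_smul,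
      smul_eq_mul, ht]
    congr 1
    field_simp
  have hy1 : ‖‖y‖⁻¹ • y‖ = 1 := by rw [norm_smul, norm_inv, norm_norm, inv_mul_cancel₀ hy0.ne']
  have hf1 : ‖‖f‖⁻¹ • f‖ = 1 := by rw [norm_smul, norm_inv, norm_norm, inv_mul_cancel₀ hf0.ne']
  have bound : ∀ ε : ℝ, 0 < ε → ε ≤ 1 → (1 + t) * (1 - 2 * ε) ≤ ‖G + f.smulRight y‖ := by
    intro ε hε hε1
    obtain ⟨f₁, hf₁, ε₁, hε₁, hsub, hlt⟩ := h _ hy1 _ hf1 ε hε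
    obtain ⟨x, hx⟩ := ballSlice_nonempty hf₁ hε₁
    rw [hT]
    exact le_norm_add_smulRight hG.le hy1.le hε.le hε1 ht0.le (hsub hx) (hlt x hx)
  by_contra! hlt
  set d := 1 + t - ‖G + f.smulRight y‖ with hd
  have hd0 : 0 < d := by linarith
  have hdt : d ≤ 1 + t := by linarith [norm_nonneg (G + f.smulRight y)]
  have hb := bound (d / (4 * (1 + t))) (by positivity)
    ((div_le_one (by positivity)).2 (by linarith))
  have hcalc : (1 + t) * (1 - 2 * (d / (4 * (1 + t)))) = 1 + t - d / 2 := by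
    field_simp
    ring
  linarith
end

section
/- Let X and Y be real Banach spaces and let G : X → Y be a bounded linear operator with ‖G‖ = 1 and adjoint G* : Y* → X*. Then G is a Daugavet center if and only if for every x₀* in the unit sphere S_{X*} of X*, every y₀ in the unit sphere S_Y of Y, and every ε₀ > 0, there exists y* in the closed unit ball B_{Y*} of Y* with y*(y₀) ≥ 1 − ε₀ and ‖G*y* + x₀*‖ > 2 − ε₀. -/
theorem ContinuousLinearMap.exists_norm_lt_one_lt_apply {X : Type*} [NormedAddCommGroup X]
    [NormedSpace ℝ X] (f : X →L[ℝ] ℝ) {r : ℝ} (hr : r < ‖f‖) : ∃ x, ‖x‖ < 1 ∧ r < f x := by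
  obtain ⟨x, hx, hrx⟩ := f.exists_lt_apply_of_lt_opNorm hr
  rcases lt_abs.mp (Real.norm_eq_abs (f x) ▸ hrx) with h | h
  · exact ⟨x, hx, h⟩
  · exact ⟨-x, by rwa [norm_neg], by rwa [map_neg]⟩

/-- If two unit vectors satisfy `‖u + v‖ = 2`, then the triangle inequality for `u` and any
nonnegative multiple of `v` is an equality. -/
theorem norm_add_smul_eq_of_norm_add_eq_two {E : Type*} [NormedAddCommGroup E] [NormedSpace ℝ E]
    {u v : E} (hu : ‖u‖ = 1) (hv : ‖v‖ = 1) (huv : 2 ≤ ‖u + v‖) {t : ℝ} (ht : 0 ≤ t) :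
    ‖u + t • v‖ = 1 + t := by
  apply le_antisymm
  · have h := norm_add_le u (t • v)
    rwa [norm_smul, hu, hv, Real.norm_of_nonneg ht, mul_one] at h
  · rcases le_total t 1 with h1 | h1
    · have h := norm_add_le (u + t • v) ((1 - t) • v)
      rw [norm_smul, hv, Real.norm_of_nonneg (sub_nonneg.mpr h1),
        show u + t • v + (1 - t) • v = u + v by module] at h
      linarith
    · have h := norm_add_le (u + t • v) ((t - 1) • u)
      rw [norm_smul, hu, Real.norm_of_nonneg (sub_nonneg.mpr h1),
        show u + t • v + (t - 1) • u = t • (u + v) by module, norm_smul,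
        Real.norm_of_nonneg ht] at h
      nlinarith

theorem isDaugavetCenter_iff_two_le_norm {X Y : Type*} [NormedAddCommGroup X] [NormedSpace ℝ X]
    [NormedAddCommGroup Y] [NormedSpace ℝ Y] {G : X →L[ℝ] Y} (hG : ‖G‖ = 1) :
    IsDaugavetCenter G ↔ ∀ x' : X →L[ℝ] ℝ, ‖x'‖ = 1 → ∀ y : Y, ‖y‖ = 1 →
      2 ≤ ‖G + x'.smulRight y‖ := by
  constructor
  · intro h x' hx' y hy
    rw [h x' y, hG, ContinuousLinearMap.norm_smulRight_apply, hx', hy]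
    norm_num
  · intro h x' y
    rcases eq_or_ne x' 0 with rfl | hx'
    · simp
    rcases eq_or_ne y 0 with rfl | hy
    · simp
    have hx1 : ‖‖x'‖⁻¹ • x'‖ = 1 := norm_smul_inv_norm (𝕜 := ℝ) hx'
    have hy1 : ‖‖y‖⁻¹ • y‖ = 1 := norm_smul_inv_norm (𝕜 := ℝ) hy
    have hT : x'.smulRight y
        = (‖x'‖ * ‖y‖) • (‖x'‖⁻¹ • x').smulRight (‖y‖⁻¹ • y) := by
      have := norm_ne_zero_iff.mpr hx'
      have := norm_ne_zero_iff.mpr hy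
      ext x
      simp only [ContinuousLinearMap.smulRight_apply, smul_apply, smul_smul,
        smul_eq_mul]
      congr 1
      field_simp
    rw [ContinuousLinearMap.norm_smulRight_apply, hG, hT]
    exact norm_add_smul_eq_of_norm_add_eq_two hG
      (by rw [ContinuousLinearMap.norm_smulRight_apply, hx1, hy1, one_mul])
      (h _ hx1 _ hy1) (by positivity)

theorem stmt3 {X Y : Type*} [NormedAddCommGroup X] [NormedSpace ℝ X] [CompleteSpace X]
    [NormedAddCommGroup Y] [NormedSpace ℝ Y] [CompleteSpace Y]
    (G : X →L[ℝ] Y) (hG : ‖G‖ = 1) :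
    IsDaugavetCenter G ↔
      ∀ x₀' : X →L[ℝ] ℝ, ‖x₀'‖ = 1 → ∀ y₀ : Y, ‖y₀‖ = 1 → ∀ ε₀ : ℝ, 0 < ε₀ →
        ∃ y' : Y →L[ℝ] ℝ, ‖y'‖ ≤ 1 ∧ y' y₀ ≥ 1 - ε₀ ∧ ‖y'.comp G + x₀'‖ > 2 - ε₀ := by
  rw [isDaugavetCenter_iff_two_le_norm hG]
  constructor
  · intro h x₀' hx₀' y₀ hy₀ ε₀ hε₀
    set δ := min ε₀ 1
    have hδ : 0 < δ := lt_min hε₀ one_pos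
    have hδε : δ ≤ ε₀ := min_le_left _ _
    have hδ1 : δ ≤ 1 := min_le_right _ _
    obtain ⟨x, hx, hx0, hxG⟩ : ∃ x : X, ‖x‖ < 1 ∧ 0 ≤ x₀' x ∧ 2 - δ < ‖G x + x₀' x • y₀‖ := by
      obtain ⟨x, hx, hxG⟩ := (G + x₀'.smulRight y₀).exists_lt_apply_of_lt_opNorm
        (r := 2 - δ) (by linarith [h x₀' hx₀' y₀ hy₀])
      have hxG : 2 - δ < ‖G x + x₀' x • y₀‖ := hxG
      rcases le_total 0 (x₀' x) with h0 | h0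
      · exact ⟨x, hx, h0, hxG⟩
      · refine ⟨-x, by rwa [norm_neg], by rw [map_neg]; linarith, ?_⟩
        rwa [map_neg, map_neg, neg_smul, ← neg_add, norm_neg]
    obtain ⟨y', hy', hy'G⟩ := exists_dual_vector'' ℝ (G x + x₀' x • y₀)
    have hsum : 2 - δ < y' (G x) + x₀' x * y' y₀ := by
      have hy'G : y' (G x + x₀' x • y₀) = ‖G x + x₀' x • y₀‖ := hy'G
      rwa [← hy'G, map_add, map_smul, smul_eq_mul] at hxG
    have hx₀x : x₀' x ≤ 1 :=
      (le_abs_self _).trans ((x₀'.unit_le_opNorm x hx.le).trans hx₀'.le)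
    have hy'y : y' y₀ ≤ 1 :=
      (le_abs_self _).trans ((y'.unit_le_opNorm y₀ hy₀.le).trans hy')
    have hGx : y' (G x) ≤ 1 :=
      (le_abs_self _).trans
        ((y'.unit_le_opNorm _ ((G.unit_le_opNorm x hx.le).trans hG.le)).trans hy')
    have happ : y' (G x) + x₀' x ≤ ‖y'.comp G + x₀'‖ :=
      (le_abs_self _).trans ((y'.comp G + x₀').unit_le_opNorm x hx.le)
    refine ⟨y', hy', ?_, ?_⟩
    · by_contra! hlt
      rcases le_total 0 (y' y₀) with h0 | h0 <;> nlinarith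
    · nlinarith
  · intro h x' hx' y hy
    refine le_of_forall_pos_le_add fun ε hε ↦ ?_
    obtain ⟨y', hy', hy'y, hnorm⟩ := h x' hx' y hy (ε / 2) (half_pos hε)
    obtain ⟨x, hx, hsum⟩ := (y'.comp G + x').exists_norm_lt_one_lt_apply hnorm
    have hsum : 2 - ε / 2 < y' (G x) + x' x := hsum
    have hx'x : x' x ≤ 1 :=
      (le_abs_self _).trans ((x'.unit_le_opNorm x hx.le).trans hx'.le)
    have hy'y1 : y' y ≤ 1 :=
      (le_abs_self _).trans ((y'.unit_le_opNorm y hy.le).trans hy')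
    have happ : y' (G x) + x' x * y' y ≤ ‖G + x'.smulRight y‖ := by
      calc y' (G x) + x' x * y' y = y' ((G + x'.smulRight y) x) := by simp
        _ ≤ ‖y' ((G + x'.smulRight y) x)‖ := le_abs_self _
        _ ≤ ‖y'‖ * ‖(G + x'.smulRight y) x‖ := y'.le_opNorm _
        _ ≤ 1 * ‖G + x'.smulRight y‖ := by
          gcongr
          exact (G + x'.smulRight y).unit_le_opNorm x hx.le
        _ = ‖G + x'.smulRight y‖ := one_mul _
    nlinarith [mul_nonneg (sub_nonneg.mpr hx'x) (sub_nonneg.mpr hy'y1)]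
end

section
/- Let X and Y be real Banach spaces and let G : X → Y be a Daugavet center with ‖G‖ = 1. Then for every y ∈ Y, sup{‖y − Gx‖ : x ∈ B_X} = ‖y‖ + 1, where B_X is the closed unit ball of X. In other words, the set G(B_X) is a quasi-ball. -/
/-- For a Daugavet center `G` of norm one, the distances from `y` to points of `G(B_X)`
come arbitrarily close to `‖y‖ + 1`. -/
theorem IsDaugavetCenter.exists_lt_norm_sub {X Y : Type*} [NormedAddCommGroup X]
    [NormedSpace ℝ X] [NormedAddCommGroup Y] [NormedSpace ℝ Y] {G : X →L[ℝ] Y}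
    (hG : ‖G‖ = 1) (hDC : IsDaugavetCenter G) (y : Y) {w : ℝ} (hw : w < ‖y‖ + 1) :
    ∃ x : X, ‖x‖ ≤ 1 ∧ w < ‖y - G x‖ := by
  have : Nontrivial X := by
    by_contra h
    rw [not_nontrivial_iff_subsingleton] at h
    simp [Subsingleton.elim G 0] at hG
  obtain ⟨x₀, hx₀⟩ := exists_ne (0 : X)
  obtain ⟨f, hf, -⟩ := exists_dual_vector ℝ x₀ (norm_ne_zero_iff.2 hx₀)
  have hnorm : ‖G + f.smulRight (-y)‖ = 1 + ‖y‖ := by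
    rw [hDC, hG, ContinuousLinearMap.norm_smulRight_apply, norm_neg, hf, one_mul]
  obtain ⟨ε, hε, hwε⟩ : ∃ ε : ℝ, 0 < ε ∧ w + 2 * ε = ‖y‖ + 1 :=
    ⟨(‖y‖ + 1 - w) / 2, by linarith, by ring⟩
  obtain ⟨x, hx, hlt, hpos⟩ :
      ∃ x : X, ‖x‖ ≤ 1 ∧ 1 + ‖y‖ - ε < ‖G x - f x • y‖ ∧ 0 ≤ f x := by
    obtain ⟨x, hx, hlt⟩ := (G + f.smulRight (-y)).exists_lt_apply_of_lt_opNorm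
      (show 1 + ‖y‖ - ε < _ by rw [hnorm]; linarith)
    have hlt' : 1 + ‖y‖ - ε < ‖G x - f x • y‖ := by
      simpa [sub_eq_add_neg] using hlt
    rcases le_total 0 (f x) with h | h
    · exact ⟨x, hx.le, hlt', h⟩
    · refine ⟨-x, by rw [norm_neg]; exact hx.le, ?_, by simpa using h⟩
      rwa [map_neg, map_neg, neg_smul, ← neg_sub', norm_neg]
  refine ⟨x, hx, ?_⟩
  have hfx : f x ≤ 1 := by
    have := f.le_of_opNorm_le hf.le x
    rw [Real.norm_eq_abs] at this
    linarith [le_abs_self (f x)]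
  have hGx : ‖G x‖ ≤ 1 := by linarith [G.le_of_opNorm_le hG.le x]
  have hupper : ‖G x - f x • y‖ ≤ ‖G x‖ + f x * ‖y‖ := by
    simpa [norm_smul, abs_of_nonneg hpos] using norm_sub_le (G x) (f x • y)
  have hsplit : ‖G x - f x • y‖ ≤ ‖y - G x‖ + (1 - f x) * ‖y‖ := by
    have h := norm_sub_le ((1 - f x) • y) (y - G x)
    rw [norm_smul, Real.norm_of_nonneg (sub_nonneg.2 hfx)] at h
    have he : (1 - f x) • y - (y - G x) = G x - f x • y := by module
    rw [he] at h
    linarith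
  linarith

/-- If `G` is a Daugavet center of norm one, then `G(B_X)` is a quasi-ball:
`r_y(G(B_X)) = ‖y‖ + 1` for every `y ∈ Y` (note `r_0(G(B_X)) = ‖G‖ = 1`). -/
theorem stmt4 {X Y : Type*} [NormedAddCommGroup X] [NormedSpace ℝ X] [CompleteSpace X]
    [NormedAddCommGroup Y] [NormedSpace ℝ Y] [CompleteSpace Y]
    (G : X →L[ℝ] Y) (hG : ‖G‖ = 1) (hDC : IsDaugavetCenter G) :
    ∀ y : Y, sSup {r : ℝ | ∃ x : X, ‖x‖ ≤ 1 ∧ r = ‖y - G x‖} = ‖y‖ + 1 := by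
  intro y
  refine csSup_eq_of_forall_le_of_forall_lt_exists_gt ⟨_, 0, by simp, rfl⟩ ?_ ?_
  · rintro _ ⟨x, hx, rfl⟩
    linarith [norm_sub_le y (G x), G.le_of_opNorm_le hG.le x]
  · intro w hw
    obtain ⟨x, hx, hlt⟩ := hDC.exists_lt_norm_sub hG y hw
    exact ⟨_, ⟨x, hx, rfl⟩, hlt⟩
end

section
/- Let X and Y be real Banach spaces and let G : X → Y be a Daugavet center with ‖G‖ = 1. Then for every y ∈ Y and every real number r with 0 ≤ r < sup{‖y − Gx‖ : x ∈ B_X}, the closed unit ball B_X of X is contained in the closed convex hull of the set B_X \ G⁻¹(B̄_Y(y, r)), where B̄_Y(y, r) denotes the closed ball in Y of radius r centered at y. -/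
open Metric

/-- If `G` is a Daugavet center of norm one and `y ≠ 0`, every slice of the unit ball contains a
point whose image is at distance almost `1 + ‖y‖` from `y`. -/
theorem IsDaugavetCenter.exists_mem_slice_of_ne_zero {X Y : Type*}
    [NormedAddCommGroup X] [NormedSpace ℝ X] [NormedAddCommGroup Y] [NormedSpace ℝ Y]
    {G : X →L[ℝ] Y} (hG : ‖G‖ = 1) (hDC : IsDaugavetCenter G) {f : X →L[ℝ] ℝ} (hf : ‖f‖ = 1)
    {y : Y} (hy : y ≠ 0) {r c : ℝ} (hr : r < 1 + ‖y‖) (hc : c < 1) :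
    ∃ x : X, ‖x‖ ≤ 1 ∧ c < f x ∧ r < ‖y - G x‖ := by
  have hy0 : 0 < ‖y‖ := norm_pos_iff.mpr hy
  obtain ⟨δ, hδ, hδc, hδr⟩ : ∃ δ : ℝ, 0 < δ ∧ δ ≤ (1 - c) * ‖y‖ ∧ 2 * δ ≤ 1 + ‖y‖ - r :=
    ⟨min ((1 - c) * ‖y‖) ((1 + ‖y‖ - r) / 2),
      lt_min (mul_pos (by linarith) hy0) (by linarith), min_le_left _ _,
      by linarith [min_le_right ((1 - c) * ‖y‖) ((1 + ‖y‖ - r) / 2)]⟩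
  have hnorm : 1 + ‖y‖ - δ < ‖G + f.smulRight (-y)‖ := by
    rw [hDC, hG, ContinuousLinearMap.norm_smulRight_apply, hf, norm_neg]
    linarith
  obtain ⟨x, hx, hfx, hGx⟩ :
      ∃ x : X, ‖x‖ ≤ 1 ∧ 0 ≤ f x ∧ 1 + ‖y‖ - δ < ‖G x - f x • y‖ := by
    obtain ⟨x, hx, hGx⟩ := ContinuousLinearMap.exists_lt_apply_of_lt_opNorm _ hnorm
    have hGx' : 1 + ‖y‖ - δ < ‖G x - f x • y‖ := by simpa [sub_eq_add_neg] using hGx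
    rcases le_total 0 (f x) with h | h
    · exact ⟨x, hx.le, h, hGx'⟩
    · refine ⟨-x, by simpa using hx.le, by simpa using h, ?_⟩
      have h' : G (-x) - f (-x) • y = -(G x - f x • y) := by
        rw [map_neg, map_neg, neg_smul]
        abel
      rwa [h', norm_neg]
  have hfx1 : f x ≤ 1 := (le_abs_self _).trans
    (by simpa [hf] using f.le_of_opNorm_le_of_le hf.le hx)
  have hGx1 : ‖G x‖ ≤ 1 := by simpa [hG] using G.le_of_opNorm_le_of_le hG.le hx
  have hupper : ‖G x - f x • y‖ ≤ 1 + f x * ‖y‖ := by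
    have := norm_sub_le (G x) (f x • y)
    rw [norm_smul, Real.norm_of_nonneg hfx] at this
    linarith
  have hlower : ‖G x - f x • y‖ ≤ ‖y - G x‖ + (1 - f x) * ‖y‖ := by
    have h := norm_add_le (G x - y) ((1 - f x) • y)
    rw [norm_smul, Real.norm_of_nonneg (by linarith : 0 ≤ 1 - f x)] at h
    have h' : G x - y + (1 - f x) • y = G x - f x • y := by
      rw [sub_smul, one_smul]
      abel
    rwa [h', norm_sub_rev (G x) y] at h
  refine ⟨x, hx, ?_, by linarith⟩
  by_contra! h
  linarith [mul_le_mul_of_nonneg_right h hy0.le]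

/-- If `G` is a Daugavet center of norm one, every slice of the unit ball contains a point whose
image is at distance almost `1 + ‖y‖` from `y`. -/
theorem IsDaugavetCenter.exists_mem_slice {X Y : Type*}
    [NormedAddCommGroup X] [NormedSpace ℝ X] [NormedAddCommGroup Y] [NormedSpace ℝ Y]
    {G : X →L[ℝ] Y} (hG : ‖G‖ = 1) (hDC : IsDaugavetCenter G) {f : X →L[ℝ] ℝ} (hf : ‖f‖ = 1)
    {y : Y} {r c : ℝ} (hr : r < 1 + ‖y‖) (hc : c < 1) :
    ∃ x : X, ‖x‖ ≤ 1 ∧ c < f x ∧ r < ‖y - G x‖ := by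
  by_cases hy : y = 0
  · subst hy
    obtain ⟨z, hz⟩ : ∃ z : Y, z ≠ 0 := by
      by_contra! h
      have : G = 0 := by ext x; exact h _
      simp [this] at hG
    rw [norm_zero] at hr
    obtain ⟨x, hx, hcx, hrx⟩ := hDC.exists_mem_slice_of_ne_zero hG hf hz
      (by linarith : r + ‖z‖ < 1 + ‖z‖) hc
    refine ⟨x, hx, hcx, ?_⟩
    rw [zero_sub, norm_neg]
    linarith [norm_sub_le z (G x)]
  · exact hDC.exists_mem_slice_of_ne_zero hG hf hy hr hc

theorem stmt5 {X Y : Type*} [NormedAddCommGroup X] [NormedSpace ℝ X] [CompleteSpace X]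
    [NormedAddCommGroup Y] [NormedSpace ℝ Y] [CompleteSpace Y]
    (G : X →L[ℝ] Y) (hG : ‖G‖ = 1) (hDC : IsDaugavetCenter G) :
    ∀ (y : Y) (r : ℝ), 0 ≤ r →
      r < sSup {d : ℝ | ∃ x : X, ‖x‖ ≤ 1 ∧ d = ‖y - G x‖} →
      closedBall (0 : X) 1 ⊆
        closure (convexHull ℝ (closedBall (0 : X) 1 \ G ⁻¹' (closedBall y r))) := by
  intro y r _ hr x₀ hx₀
  obtain ⟨_, ⟨x₁, hx₁, rfl⟩, hrx₁⟩ := exists_lt_of_lt_csSup (by exact ⟨_, 0, by simp, rfl⟩) hr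
  have hry : r < 1 + ‖y‖ := by
    have hGx₁ : ‖G x₁‖ ≤ 1 := by simpa [hG] using G.le_of_opNorm_le_of_le hG.le hx₁
    linarith [norm_sub_le y (G x₁)]
  by_contra hmem
  obtain ⟨f, u, hlt, hu⟩ := geometric_hahn_banach_closed_point
    (convex_convexHull ℝ _).closure isClosed_closure hmem
  have hslice : ∀ x : X, ‖x‖ ≤ 1 → r < ‖y - G x‖ → f x < u := fun x hx hrx =>
    hlt x <| subset_closure <| subset_convexHull ℝ _
      ⟨by simpa using hx, by simpa [dist_eq_norm, norm_sub_rev] using hrx⟩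
  have hf : f ≠ 0 := by
    rintro rfl
    exact lt_asymm hu (hslice x₁ hx₁ hrx₁)
  have hf0 : 0 < ‖f‖ := norm_pos_iff.mpr hf
  have huf : u < ‖f‖ := hu.trans_le <| (le_abs_self _).trans <| by
    simpa using f.le_of_opNorm_le_of_le le_rfl (mem_closedBall_zero_iff.mp hx₀)
  obtain ⟨x, hx, hux, hrx⟩ := hDC.exists_mem_slice hG (f := ‖f‖⁻¹ • f)
    (by rw [norm_smul, norm_inv, norm_norm, inv_mul_cancel₀ hf0.ne']) hry
    ((div_lt_one hf0).mpr huf)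
  have hux' : u / ‖f‖ < f x / ‖f‖ := by
    simpa [div_eq_inv_mul] using hux
  exact lt_asymm ((div_lt_div_iff_of_pos_right hf0).mp hux') (hslice x hx hrx)
end

section
/- Let X and Y be real Banach spaces, G : X → Y a bounded linear operator, M a linear subspace of the space L(X, Y) of bounded linear operators, and C > 0 a constant such that ‖G + T‖ ≥ C + ‖T‖ for every T ∈ M. Let Γ be an index set, let (T_n)_{n∈Γ} be a family of operators in M, and let T̃ : X → Y be a bounded linear operator such that for every x ∈ X the family (T_n x)_{n∈Γ} is unconditionally summable to T̃x (i.e., the net of finite partial sums over finite subsets of Γ converges to T̃x). Then ‖G − T̃‖ ≥ C. -/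
theorem Summable.exists_norm_sum_le {ι E : Type*} [SeminormedAddCommGroup E] {f : ι → E}
    (hf : Summable f) : ∃ K : ℝ, ∀ s : Finset ι, ‖∑ i ∈ s, f i‖ ≤ K := by
  classical
  obtain ⟨a, ha⟩ := hf
  obtain ⟨s₀, hs₀⟩ := Filter.mem_atTop_sets.1 (ha.eventually (Metric.ball_mem_nhds a one_pos))
  refine ⟨‖a‖ + 1 + ∑ i ∈ s₀, ‖f i‖, fun s => ?_⟩
  have h₁ : ‖∑ i ∈ s ∪ s₀, f i‖ ≤ ‖a‖ + 1 :=
    norm_le_norm_add_const_of_dist_le (hs₀ _ Finset.subset_union_right).le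
  have h₂ : ‖∑ i ∈ s₀ \ s, f i‖ ≤ ∑ i ∈ s₀, ‖f i‖ :=
    (norm_sum_le _ _).trans (Finset.sum_le_sum_of_subset_of_nonneg Finset.sdiff_subset
      fun _ _ _ => norm_nonneg _)
  have h₃ : ∑ i ∈ s, f i = ∑ i ∈ s ∪ s₀, f i - ∑ i ∈ s₀ \ s, f i := by
    rw [← Finset.union_sdiff_self_eq_union, Finset.sum_union Finset.disjoint_sdiff,
      add_sub_cancel_right]
  rw [h₃]
  exact (norm_sub_le _ _).trans (add_le_add h₁ h₂)

theorem ContinuousLinearMap.norm_sub_sum_le_of_hasSum {ι X Y : Type*}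
    [NormedAddCommGroup X] [NormedSpace ℝ X] [NormedAddCommGroup Y] [NormedSpace ℝ Y]
    {T : ι → X →L[ℝ] Y} {S : X →L[ℝ] Y} (hT : ∀ x, HasSum (fun i => T i x) (S x))
    {K : ℝ} (hK : ∀ s : Finset ι, ‖∑ i ∈ s, T i‖ ≤ K) (s : Finset ι) :
    ‖S - ∑ i ∈ s, T i‖ ≤ K := by
  classical
  refine ContinuousLinearMap.opNorm_le_bound _ ((norm_nonneg _).trans (hK ∅)) fun x => ?_
  refine le_of_tendsto ((hT x).sub_const ((∑ i ∈ s, T i) x)).norm ?_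
  filter_upwards [Filter.eventually_ge_atTop s] with t ht
  have h : ∑ i ∈ t, T i x - (∑ i ∈ s, T i) x = (∑ i ∈ t \ s, T i) x := by
    simp only [sum_apply, sub_eq_iff_eq_add]
    exact (Finset.sum_sdiff ht).symm
  rw [h]
  exact ContinuousLinearMap.le_of_opNorm_le _ (hK _) x

theorem stmt8 {X Y : Type*} [NormedAddCommGroup X] [NormedSpace ℝ X] [CompleteSpace X]
    [NormedAddCommGroup Y] [NormedSpace ℝ Y] [CompleteSpace Y]
    (G : X →L[ℝ] Y) (M : Submodule ℝ (X →L[ℝ] Y)) (C : ℝ) (hC : 0 < C)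
    (hGM : ∀ T ∈ M, ‖G + T‖ ≥ C + ‖T‖)
    {Γ : Type*} (T : Γ → (X →L[ℝ] Y)) (hTM : ∀ n, T n ∈ M)
    (Ttilde : X →L[ℝ] Y) (hsum : ∀ x : X, HasSum (fun n => T n x) (Ttilde x)) :
    ‖G - Ttilde‖ ≥ C := by
  obtain ⟨K, hK⟩ := banach_steinhaus (g := fun s : Finset Γ => ∑ n ∈ s, T n) fun x => by
    simpa only [sum_apply] using (hsum x).summable.exists_norm_sum_le
  have hbdd : BddAbove (Set.range fun s : Finset Γ => ‖∑ n ∈ s, T n‖) :=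
    ⟨K, Set.forall_mem_range.2 hK⟩
  refine le_of_forall_pos_sub_le fun ε hε => ?_
  obtain ⟨s, hs⟩ := exists_lt_of_lt_ciSup
    (sub_lt_self (⨆ s : Finset Γ, ‖∑ n ∈ s, T n‖) hε)
  have h₁ := ContinuousLinearMap.norm_sub_sum_le_of_hasSum hsum (le_ciSup hbdd) s
  have h₂ := hGM _ (M.neg_mem (M.sum_mem fun n (_ : n ∈ s) => hTM n))
  rw [norm_neg, ← sub_eq_add_neg] at h₂
  have h₃ := norm_sub_le_norm_sub_add_norm_sub G Ttilde (∑ n ∈ s, T n)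
  linarith
end

section
/- Let X and Y be real Banach spaces and let G : X → Y be a Daugavet center with ‖G‖ = 1. Then G fixes a copy of ℓ₁: there exist a sequence (x_n)_{n∈ℕ} in the closed unit ball B_X of X and a constant c > 0 such that for every n ∈ ℕ and all real scalars a₁, …, a_n, one has ‖Σ_{i=1}^n a_i · G x_i‖ ≥ c · Σ_{i=1}^n |a_i| (so that both (x_n) and (Gx_n) are equivalent to the canonical basis of ℓ₁, and G restricted to the closed linear span of the x_n is an isomorphism onto its image). -/
/-- Every slice of the unit ball contains a smaller slice on which a given nonzero `y` is almost
`ℓ₁`-orthogonal to the values of a norm-one Daugavet center. -/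
theorem IsDaugavetCenter.exists_subslice {X Y : Type*} [NormedAddCommGroup X] [NormedSpace ℝ X]
    [NormedAddCommGroup Y] [NormedSpace ℝ Y] {G : X →L[ℝ] Y} (hG : ‖G‖ = 1)
    (hDC : IsDaugavetCenter G) {y : Y} (hy : y ≠ 0) {ε : ℝ} (hε : 0 < ε)
    {f : X →L[ℝ] ℝ} {β : ℝ} (hβ : 0 < β) (hf : ∃ x, ‖x‖ ≤ 1 ∧ β < f x) :
    ∃ (h : X →L[ℝ] ℝ) (γ : ℝ), 0 < γ ∧ (∃ x, ‖x‖ ≤ 1 ∧ γ < h x) ∧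
      ∀ x, ‖x‖ ≤ 1 → γ < h x → β < f x ∧ 1 + ‖y‖ - ε ≤ ‖G x + y‖ := by
  have hy0 : 0 < ‖y‖ := norm_pos_iff.2 hy
  have hN : β < ‖f‖ := by
    obtain ⟨x, hx, hfx⟩ := hf
    exact hfx.trans_le ((le_abs_self _).trans (f.unit_le_opNorm x hx))
  have hN0 : 0 < ‖f‖ := hβ.trans hN
  have hr : β / ‖f‖ < 1 := (div_lt_one hN0).2 hN
  have hr0 : 0 < β / ‖f‖ := by positivity
  set F : X →L[ℝ] ℝ := ‖f‖⁻¹ • f with hF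
  have hF1 : ‖F‖ = 1 := by
    rw [hF, norm_smul, norm_inv, norm_norm, inv_mul_cancel₀ hN0.ne']
  obtain ⟨δ, hδ0, hδ⟩ : ∃ δ : ℝ, 0 < δ ∧ δ < min (ε / 2) (‖y‖ * (1 - β / ‖f‖)) :=
    exists_between (lt_min (by positivity) (mul_pos hy0 (by linarith)))
  obtain ⟨hδε, hδy⟩ := lt_min_iff.1 hδ
  have hδy' : δ < ‖y‖ := by nlinarith
  have hnorm : 1 + ‖y‖ - δ < ‖G + F.smulRight y‖ := by
    rw [hDC, hG, ContinuousLinearMap.norm_smulRight_apply, hF1]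
    linarith
  obtain ⟨x₀, hx₀, hx₀'⟩ := ContinuousLinearMap.exists_lt_apply_of_lt_opNorm _ hnorm
  obtain ⟨g, z, hg, hz, hgy, hgz⟩ : ∃ (g : Y →L[ℝ] ℝ) (z : X), ‖g‖ ≤ 1 ∧ ‖z‖ ≤ 1 ∧ 0 ≤ g y ∧
      1 + ‖y‖ - δ < g (G z) + g y * F z := by
    obtain ⟨g, hg, hgx⟩ := exists_dual_vector'' ℝ ((G + F.smulRight y) x₀)
    have key : 1 + ‖y‖ - δ < g (G x₀) + g y * F x₀ := by
      have : g ((G + F.smulRight y) x₀) = g (G x₀) + g y * F x₀ := by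
        simp [mul_comm]
      rw [← this, hgx]
      exact hx₀'
    rcases le_total 0 (g y) with h | h
    · exact ⟨g, x₀, hg, hx₀.le, h, key⟩
    · refine ⟨-g, -x₀, by simpa using hg, by simpa using hx₀.le, by simpa using h, ?_⟩
      simpa using key
  refine ⟨g.comp G + g y • F, 1 + ‖y‖ - δ, by linarith, ⟨z, hz, by simpa using hgz⟩, ?_⟩
  intro x hx hgx
  have hgx' : 1 + ‖y‖ - δ < g (G x) + g y * F x := by simpa using hgx
  have hle : ∀ w, g w ≤ ‖w‖ := fun w =>
    (le_abs_self _).trans ((g.le_opNorm w).trans (by nlinarith [norm_nonneg w]))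
  have hGx : ‖G x‖ ≤ 1 := hG ▸ G.unit_le_opNorm x hx
  have hFx : F x ≤ 1 := (le_abs_self _).trans (hF1 ▸ F.unit_le_opNorm x hx)
  have h₁ := hle (G x)
  have h₂ := hle y
  have hFx0 : 0 < F x := by
    by_contra! hneg
    nlinarith
  have hfF : f x = ‖f‖ * F x := by
    simp [hF, hN0.ne']
  constructor
  · have h₃ : ‖y‖ * (β / ‖f‖) < ‖y‖ * F x := by nlinarith
    have h₄ : β / ‖f‖ < F x := lt_of_mul_lt_mul_left h₃ hy0.le
    rw [hfF, mul_comm]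
    exact (div_lt_iff₀ hN0).1 h₄
  · have h₃ := hle (G x + y)
    rw [map_add] at h₃
    nlinarith

/-- Version of `IsDaugavetCenter.exists_subslice` for finitely many vectors, zero included. -/
theorem IsDaugavetCenter.exists_slice_finset {X Y : Type*} [NormedAddCommGroup X]
    [NormedSpace ℝ X] [NormedAddCommGroup Y] [NormedSpace ℝ Y] {G : X →L[ℝ] Y} (hG : ‖G‖ = 1)
    (hDC : IsDaugavetCenter G) {ε : ℝ} (hε : 0 < ε) (s : Finset Y) :
    ∃ (h : X →L[ℝ] ℝ) (γ : ℝ), 0 < γ ∧ (∃ x, ‖x‖ ≤ 1 ∧ γ < h x) ∧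
      ∀ x, ‖x‖ ≤ 1 → γ < h x → ∀ y ∈ s, 1 + ‖y‖ - ε ≤ ‖G x + y‖ := by
  classical
  obtain ⟨x₀, hx₀⟩ : ∃ x, G x ≠ 0 := by
    by_contra! h
    have : G = 0 := ContinuousLinearMap.ext h
    simp [this] at hG
  induction s using Finset.induction_on with
  | empty =>
    have hx0 : x₀ ≠ 0 := by
      rintro rfl
      simp at hx₀
    obtain ⟨f, -, hf⟩ := exists_dual_vector'' ℝ x₀
    have hn : ‖x₀‖ ≠ 0 := norm_ne_zero_iff.2 hx0
    refine ⟨f, 1 / 2, by norm_num, ⟨‖x₀‖⁻¹ • x₀, ?_, ?_⟩, by simp⟩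
    · simp [norm_smul, hn]
    · simp [hf, hn]
      norm_num
  | insert y s _ ih =>
    obtain ⟨f, β, hβ, hf, hs⟩ := ih
    by_cases hy : y = 0
    · obtain ⟨h, γ, hγ, hne, H⟩ := hDC.exists_subslice hG hx₀ hε hβ hf
      refine ⟨h, γ, hγ, hne, fun x hx hxγ w hw => ?_⟩
      obtain ⟨h₁, h₂⟩ := H x hx hxγ
      rcases Finset.mem_insert.1 hw with rfl | hw
      · rw [hy, norm_zero, add_zero, add_zero]
        linarith [norm_add_le (G x) (G x₀)]
      · exact hs x hx h₁ w hw
    · obtain ⟨h, γ, hγ, hne, H⟩ := hDC.exists_subslice hG hy hε hβ hf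
      refine ⟨h, γ, hγ, hne, fun x hx hxγ w hw => ?_⟩
      obtain ⟨h₁, h₂⟩ := H x hx hxγ
      rcases Finset.mem_insert.1 hw with rfl | hw
      · exact h₂
      · exact hs x hx h₁ w hw

/-- A norm-one Daugavet center takes values that are almost `ℓ₁`-orthogonal to any given
finite-dimensional subspace. -/
theorem IsDaugavetCenter.exists_almost_orthogonal {X Y : Type*} [NormedAddCommGroup X]
    [NormedSpace ℝ X] [NormedAddCommGroup Y] [NormedSpace ℝ Y] {G : X →L[ℝ] Y} (hG : ‖G‖ = 1)
    (hDC : IsDaugavetCenter G) (V : Submodule ℝ Y) [FiniteDimensional ℝ V] {η : ℝ} (hη : η < 1) :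
    ∃ x, ‖x‖ ≤ 1 ∧ ∀ y ∈ V, ∀ t : ℝ, η * (‖y‖ + |t|) ≤ ‖y + t • G x‖ := by
  obtain ⟨s, -, hsfin, hs⟩ := (isCompact_closedBall (0 : V) 1).finite_cover_balls
    (show 0 < (1 - η) / 4 by linarith)
  obtain ⟨h, γ, -, ⟨x, hx, hxγ⟩, H⟩ := hDC.exists_slice_finset hG
    (show 0 < (1 - η) / 2 by linarith) (hsfin.image ((↑) : V → Y)).toFinset
  have hGx : ‖G x‖ ≤ 1 := hG ▸ G.unit_le_opNorm x hx
  have hball : ∀ y ∈ V, ‖y‖ ≤ 1 → ‖y‖ + η ≤ ‖y + G x‖ := by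
    intro y hy hy1
    obtain ⟨w, hw, hyw⟩ := Set.mem_iUnion₂.1 (hs (show (⟨y, hy⟩ : V) ∈ Metric.closedBall 0 1 by
      simpa using hy1))
    have h₁ := H x hx hxγ w (by simpa using hw)
    have h₂ : ‖y - w‖ < (1 - η) / 4 := by
      simpa [Subtype.dist_eq, dist_eq_norm] using hyw
    have h₃ : ‖G x + w‖ ≤ ‖y + G x‖ + ‖y - w‖ := by
      rw [show G x + (w : Y) = (y + G x) - (y - w) by abel]
      exact norm_sub_le _ _
    have h₄ : ‖y‖ ≤ ‖(w : Y)‖ + ‖y - w‖ := by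
      simpa using norm_add_le (w : Y) (y - w)
    linarith
  have hscale : ∀ y ∈ V, ∀ r : ℝ, ‖y‖ ≤ r → ‖y‖ + η * r ≤ ‖y + r • G x‖ := by
    intro y hy r hr
    rcases ((norm_nonneg y).trans hr).eq_or_lt with rfl | hr0
    · simp
    · have hn : ‖r⁻¹ • y‖ = r⁻¹ * ‖y‖ := by
        rw [norm_smul, norm_inv, Real.norm_of_nonneg hr0.le]
      have h₁ := hball (r⁻¹ • y) (V.smul_mem _ hy) (by
        rw [hn, inv_mul_le_iff₀ hr0, mul_one]
        exact hr)
      have h₂ : y + r • G x = r • (r⁻¹ • y + G x) := by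
        rw [smul_add, smul_inv_smul₀ hr0.ne']
      rw [h₂, norm_smul, Real.norm_of_nonneg hr0.le]
      calc ‖y‖ + η * r = r * (‖r⁻¹ • y‖ + η) := by rw [hn]; field_simp
        _ ≤ _ := by gcongr
  have hpos : ∀ y ∈ V, ∀ t : ℝ, 0 ≤ t → η * (‖y‖ + t) ≤ ‖y + t • G x‖ := by
    intro y hy t ht
    have hy0 := norm_nonneg y
    rcases le_total ‖y‖ t with hyt | hyt
    · nlinarith [hscale y hy t hyt]
    · have h₁ := hscale y hy ‖y‖ le_rfl
      have h₂ : ‖y + ‖y‖ • G x‖ ≤ ‖y + t • G x‖ + (‖y‖ - t) := by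
        rw [show y + ‖y‖ • G x = (y + t • G x) + (‖y‖ - t) • G x by module]
        refine (norm_add_le _ _).trans ?_
        rw [norm_smul, Real.norm_of_nonneg (sub_nonneg.2 hyt)]
        nlinarith
      nlinarith
  refine ⟨x, hx, fun y hy t => ?_⟩
  rcases le_total 0 t with ht | ht
  · rw [abs_of_nonneg ht]
    exact hpos y hy t ht
  · rw [abs_of_nonpos ht, ← norm_neg (y + t • G x)]
    have h₁ := hpos (-y) (V.neg_mem hy) (-t) (by linarith)
    rwa [norm_neg, neg_smul, ← neg_add] at h₁

/-- A sequence in the unit ball whose image under a norm-one Daugavet center is `ℓ₁`-like, each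
term being almost `ℓ₁`-orthogonal to the span of the previous ones. -/
theorem IsDaugavetCenter.exists_seq {X Y : Type*} [NormedAddCommGroup X]
    [NormedSpace ℝ X] [NormedAddCommGroup Y] [NormedSpace ℝ Y] {G : X →L[ℝ] Y} (hG : ‖G‖ = 1)
    (hDC : IsDaugavetCenter G) {η : ℕ → ℝ} (hη : ∀ n, η n < 1) :
    ∃ x : ℕ → X, (∀ n, ‖x n‖ ≤ 1) ∧ ∀ (n : ℕ) (a : ℕ → ℝ) (t : ℝ),
      η n * (‖∑ i ∈ Finset.range n, a i • G (x i)‖ + |t|) ≤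
        ‖∑ i ∈ Finset.range n, a i • G (x i) + t • G (x n)‖ := by
  have hex : ∀ (n : ℕ) (V : {V : Submodule ℝ Y // FiniteDimensional ℝ V}), ∃ x, ‖x‖ ≤ 1 ∧
      ∀ y ∈ V.1, ∀ t : ℝ, η n * (‖y‖ + |t|) ≤ ‖y + t • G x‖ := fun n V =>
    haveI := V.2
    hDC.exists_almost_orthogonal hG V.1 (hη n)
  choose p hp hp' using hex
  let W : ℕ → {V : Submodule ℝ Y // FiniteDimensional ℝ V} := fun n =>
    Nat.rec ⟨⊥, inferInstance⟩ (fun n V =>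
      ⟨V.1 ⊔ Submodule.span ℝ {G (p n V)}, haveI := V.2; inferInstance⟩) n
  have hW : ∀ n, (W (n + 1)).1 = (W n).1 ⊔ Submodule.span ℝ {G (p n (W n))} := fun _ => rfl
  refine ⟨fun n => p n (W n), fun n => hp _ _, fun n a t => hp' _ _ _ ?_ t⟩
  induction n with
  | zero => simp
  | succ n ih =>
    rw [Finset.sum_range_succ, hW]
    exact Submodule.add_mem_sup ih
      (Submodule.smul_mem _ _ (Submodule.mem_span_singleton_self _))

/-- A Daugavet center fixes a copy of `ℓ₁`. -/
theorem stmt10 {X Y : Type*} [NormedAddCommGroup X] [NormedSpace ℝ X] [CompleteSpace X]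
    [NormedAddCommGroup Y] [NormedSpace ℝ Y] [CompleteSpace Y]
    (G : X →L[ℝ] Y) (hG : ‖G‖ = 1) (hDC : IsDaugavetCenter G) :
    ∃ x : ℕ → X, (∀ n, ‖x n‖ ≤ 1) ∧ ∃ c : ℝ, 0 < c ∧
      ∀ (n : ℕ) (a : Fin n → ℝ),
        ‖∑ i : Fin n, a i • G (x i)‖ ≥ c * ∑ i : Fin n, |a i| := by
  set c : ℕ → ℝ := fun n => 1 / 2 + (1 / 2) ^ (n + 1) with hc
  have hpow : ∀ n : ℕ, (0 : ℝ) < (1 / 2) ^ (n + 1) := fun n => by positivity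
  have hc0 : ∀ n, 1 / 2 ≤ c n := fun n => by simp only [hc]; linarith [hpow n]
  have hc1 : ∀ n, c n ≤ 1 := fun n => by
    have : ((1 : ℝ) / 2) ^ n ≤ 1 := pow_le_one₀ (by norm_num) (by norm_num)
    simp only [hc, pow_succ]
    linarith
  have hcpos : ∀ n, 0 < c n := fun n => lt_of_lt_of_le (by norm_num) (hc0 n)
  have hlt : ∀ n, c (n + 1) / c n < 1 := fun n => by
    rw [div_lt_one (hcpos n)]
    have := hpow n
    simp only [hc]
    rw [pow_succ _ (n + 1)]
    linarith
  obtain ⟨x, hx, H⟩ := hDC.exists_seq hG hlt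
  have hmain : ∀ (n : ℕ) (a : ℕ → ℝ),
      c n * ∑ i ∈ Finset.range n, |a i| ≤ ‖∑ i ∈ Finset.range n, a i • G (x i)‖ := by
    intro n a
    induction n with
    | zero => simp
    | succ n ih =>
      rw [Finset.sum_range_succ, Finset.sum_range_succ]
      refine le_trans ?_ (H n a (a n))
      have hle : c n * |a n| ≤ |a n| := mul_le_of_le_one_left (abs_nonneg _) (hc1 n)
      have hnn : 0 ≤ c (n + 1) / c n := (div_pos (hcpos _) (hcpos _)).le
      calc c (n + 1) * (∑ i ∈ Finset.range n, |a i| + |a n|)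
          = c (n + 1) / c n * (c n * ∑ i ∈ Finset.range n, |a i| + c n * |a n|) := by
            rw [← mul_add, ← mul_assoc, div_mul_cancel₀ _ (hcpos n).ne']
        _ ≤ _ := by gcongr
  refine ⟨x, hx, 1 / 2, by norm_num, fun n a => ?_⟩
  have h := hmain n (fun i => if hi : i < n then a ⟨i, hi⟩ else 0)
  simp only [Finset.sum_range, Fin.is_lt, dite_true, Fin.eta] at h
  exact le_trans (mul_le_mul_of_nonneg_right (hc0 n)
    (Finset.sum_nonneg fun i _ => abs_nonneg _)) h
end

section
/- Let X₁, X₂, Y₁, Y₂ be real Banach spaces and let G₁ : X₁ → Y₁ and G₂ : X₂ → Y₂ be Daugavet centers with ‖G₁‖ = ‖G₂‖ = 1. Then the operator G : X₁ ⊕_∞ X₂ → Y₁ ⊕_∞ Y₂ defined by G(x₁, x₂) = (G₁x₁, G₂x₂) is a Daugavet center, where ⊕_∞ denotes the direct sum equipped with the maximum norm ‖(u, v)‖ = max{‖u‖, ‖v‖}. -/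
/-- Every functional on a nontrivial space is a nonnegative multiple of a norm-one functional. -/
theorem exists_norm_one_eq_norm_smul {X : Type*} [NormedAddCommGroup X] [NormedSpace ℝ X]
    [Nontrivial X] (φ : X →L[ℝ] ℝ) : ∃ f : X →L[ℝ] ℝ, ‖f‖ = 1 ∧ φ = ‖φ‖ • f := by
  by_cases hφ : φ = 0
  · obtain ⟨x, hx⟩ := exists_ne (0 : X)
    obtain ⟨f, hf, -⟩ := exists_dual_vector ℝ x (norm_ne_zero_iff.mpr hx)
    exact ⟨f, hf, by simp [hφ]⟩
  · have h : ‖φ‖ ≠ 0 := norm_ne_zero_iff.mpr hφ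
    refine ⟨‖φ‖⁻¹ • φ, ?_, (smul_inv_smul₀ h φ).symm⟩
    rw [norm_smul, norm_inv, norm_norm, inv_mul_cancel₀ h]

/-- A functional nearly attains its norm at a point of the unit ball with nonnegative value. -/
theorem exists_norm_le_one_sub_le_apply {X : Type*} [NormedAddCommGroup X] [NormedSpace ℝ X]
    (φ : X →L[ℝ] ℝ) {ε : ℝ} (hε : 0 < ε) : ∃ x, ‖x‖ ≤ 1 ∧ 0 ≤ φ x ∧ ‖φ‖ - ε ≤ φ x := by
  obtain ⟨x, hx, hφx⟩ := φ.exists_lt_apply_of_lt_opNorm (sub_lt_self ‖φ‖ hε)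
  rw [Real.norm_eq_abs] at hφx
  rcases le_total 0 (φ x) with h | h
  · exact ⟨x, hx.le, h, by rw [abs_of_nonneg h] at hφx; exact hφx.le⟩
  · refine ⟨-x, by simpa using hx.le, by simpa using h, ?_⟩
    rw [abs_of_nonpos h] at hφx
    simpa using hφx.le

namespace IsDaugavetCenter

variable {X Z Y : Type*} [NormedAddCommGroup X] [NormedSpace ℝ X]
  [NormedAddCommGroup Z] [NormedSpace ℝ Z] [NormedAddCommGroup Y] [NormedSpace ℝ Y]

/-- The Daugavet equation for `G` persists, approximately, after adding a nonnegative constant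
to the functional. -/
theorem exists_le_norm_add_smul {G : X →L[ℝ] Y} (hG : ‖G‖ = 1) (hDC : IsDaugavetCenter G)
    (φ : X →L[ℝ] ℝ) (y : Y) {c ε : ℝ} (hc : 0 ≤ c) (hε : 0 < ε) :
    ∃ x, ‖x‖ ≤ 1 ∧ 1 + (‖φ‖ + c) * ‖y‖ - ε ≤ ‖G x + (φ x + c) • y‖ := by
  have : Nontrivial X := by
    by_contra h
    rw [not_nontrivial_iff_subsingleton] at h
    simp [Subsingleton.elim G 0] at hG
  obtain ⟨f, hf, hφ⟩ := exists_norm_one_eq_norm_smul φ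
  set a := ‖φ‖
  have ha : 0 ≤ a := norm_nonneg φ
  have hnorm : ‖G + f.smulRight ((a + c) • y)‖ = 1 + (a + c) * ‖y‖ := by
    rw [hDC, hG, ContinuousLinearMap.norm_smulRight_apply, hf, one_mul, norm_smul,
      Real.norm_of_nonneg (add_nonneg ha hc)]
  obtain ⟨x, hx, hfx, hGx⟩ : ∃ x, ‖x‖ ≤ 1 ∧ 0 ≤ f x ∧
      1 + (a + c) * ‖y‖ - ε / 2 < ‖G x + f x • (a + c) • y‖ := by
    obtain ⟨x, hx, hGx⟩ :=
      (G + f.smulRight ((a + c) • y)).exists_lt_apply_of_lt_opNorm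
        (r := 1 + (a + c) * ‖y‖ - ε / 2)
        (by rw [hnorm]; exact sub_lt_self _ (half_pos hε))
    simp only [add_apply, ContinuousLinearMap.smulRight_apply] at hGx
    rcases le_total 0 (f x) with h | h
    · exact ⟨x, hx.le, h, hGx⟩
    · refine ⟨-x, by simpa using hx.le, by simpa using h, ?_⟩
      rwa [map_neg, map_neg, neg_smul, ← neg_add, norm_neg]
  have hfx1 : f x ≤ 1 :=
    (le_abs_self _).trans ((f.le_opNorm x).trans (by rw [hf, one_mul]; exact hx))
  have hGx1 : ‖G x‖ ≤ 1 := (G.le_opNorm x).trans (by rw [hG, one_mul]; exact hx)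
  have hupper : ‖G x + f x • (a + c) • y‖ ≤ 1 + f x * ((a + c) * ‖y‖) := by
    refine (norm_add_le _ _).trans (add_le_add hGx1 ?_)
    rw [norm_smul, norm_smul, Real.norm_of_nonneg hfx, Real.norm_of_nonneg (add_nonneg ha hc)]
  have hsplit : G x + f x • (a + c) • y =
      (G x + (φ x + c) • y) - ((1 - f x) * c) • y := by
    have : φ x = a * f x := by rw [hφ]; rfl
    rw [this]
    module
  have hdiff : ‖((1 - f x) * c) • y‖ ≤ (1 - f x) * ((a + c) * ‖y‖) := by
    rw [norm_smul, Real.norm_of_nonneg (mul_nonneg (sub_nonneg.mpr hfx1) hc), mul_assoc]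
    gcongr
    exact le_add_of_nonneg_left ha
  refine ⟨x, hx, ?_⟩
  have htri := hsplit ▸ norm_sub_le (G x + (φ x + c) • y) (((1 - f x) * c) • y)
  linarith

/-- A uniform bound for `G x + (φ x + ψ z) • y` on the product of the unit balls is at least
`1 + (‖φ‖ + ‖ψ‖) * ‖y‖`. -/
theorem one_add_mul_norm_le {G : X →L[ℝ] Y} (hG : ‖G‖ = 1) (hDC : IsDaugavetCenter G)
    (φ : X →L[ℝ] ℝ) (ψ : Z →L[ℝ] ℝ) (y : Y) {K : ℝ}
    (hK : ∀ x z, ‖x‖ ≤ 1 → ‖z‖ ≤ 1 → ‖G x + (φ x + ψ z) • y‖ ≤ K) :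
    1 + (‖φ‖ + ‖ψ‖) * ‖y‖ ≤ K := by
  refine le_of_forall_pos_le_add fun ε hε => ?_
  have hy : 0 < 1 + ‖y‖ := by positivity
  have hδ : 0 < ε / (1 + ‖y‖) := div_pos hε hy
  obtain ⟨z, hz, hz0, hψz⟩ := exists_norm_le_one_sub_le_apply ψ hδ
  obtain ⟨x, hx, hGx⟩ := exists_le_norm_add_smul hG hDC φ y hz0 hδ
  have hmul := mul_le_mul_of_nonneg_right hψz (norm_nonneg y)
  have hε' : ε / (1 + ‖y‖) * (1 + ‖y‖) = ε := div_mul_cancel₀ ε hy.ne'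
  linarith [hK x z hx hz]

end IsDaugavetCenter

/-- The `⊕_∞` sum of two norm-one Daugavet centers is a Daugavet center.
(The product of normed spaces carries the max norm in Mathlib.) -/
theorem stmt13 {X₁ X₂ Y₁ Y₂ : Type*}
    [NormedAddCommGroup X₁] [NormedSpace ℝ X₁] [CompleteSpace X₁]
    [NormedAddCommGroup X₂] [NormedSpace ℝ X₂] [CompleteSpace X₂]
    [NormedAddCommGroup Y₁] [NormedSpace ℝ Y₁] [CompleteSpace Y₁]
    [NormedAddCommGroup Y₂] [NormedSpace ℝ Y₂] [CompleteSpace Y₂]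
    (G₁ : X₁ →L[ℝ] Y₁) (G₂ : X₂ →L[ℝ] Y₂)
    (hG₁ : ‖G₁‖ = 1) (hG₂ : ‖G₂‖ = 1)
    (hDC₁ : IsDaugavetCenter G₁) (hDC₂ : IsDaugavetCenter G₂) :
    IsDaugavetCenter (G₁.prodMap G₂) := by
  intro φ y
  set φ₁ := φ.comp (ContinuousLinearMap.inl ℝ X₁ X₂)
  set φ₂ := φ.comp (ContinuousLinearMap.inr ℝ X₁ X₂)
  have hφ (x₁ : X₁) (x₂ : X₂) : φ (x₁, x₂) = φ₁ x₁ + φ₂ x₂ := by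
    simp [φ₁, φ₂, ← map_add]
  have hφ_norm : ‖φ‖ ≤ ‖φ₁‖ + ‖φ₂‖ := by
    refine φ.opNorm_le_bound (by positivity) fun x => ?_
    rw [← Prod.mk.eta (p := x), hφ, add_mul]
    refine norm_add_le_of_le ?_ ?_
    · exact φ₁.le_opNorm_of_le (norm_fst_le x)
    · exact φ₂.le_opNorm_of_le (norm_snd_le x)
  have hG_norm : ‖G₁.prodMap G₂‖ ≤ 1 := by
    refine ContinuousLinearMap.opNorm_le_bound _ zero_le_one fun x => ?_
    rw [one_mul]
    refine max_le_max ?_ ?_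
    · simpa [hG₁] using G₁.le_opNorm x.1
    · simpa [hG₂] using G₂.le_opNorm x.2
  set S := G₁.prodMap G₂ + φ.smulRight y
  have hS (x₁ : X₁) (x₂ : X₂) (h₁ : ‖x₁‖ ≤ 1) (h₂ : ‖x₂‖ ≤ 1) : ‖S (x₁, x₂)‖ ≤ ‖S‖ :=
    S.unit_le_opNorm _ (max_le h₁ h₂)
  have hlower : 1 + (‖φ₁‖ + ‖φ₂‖) * ‖y‖ ≤ ‖S‖ := by
    rcases max_choice ‖y.1‖ ‖y.2‖ with h | h
    · rw [Prod.norm_def y, h]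
      refine IsDaugavetCenter.one_add_mul_norm_le hG₁ hDC₁ φ₁ φ₂ y.1 fun x₁ x₂ h₁ h₂ => ?_
      rw [← hφ]
      exact (norm_fst_le (S (x₁, x₂))).trans (hS x₁ x₂ h₁ h₂)
    · rw [Prod.norm_def y, h, add_comm ‖φ₁‖]
      refine IsDaugavetCenter.one_add_mul_norm_le hG₂ hDC₂ φ₂ φ₁ y.2 fun x₂ x₁ h₂ h₁ => ?_
      rw [add_comm (φ₂ x₂), ← hφ]
      exact (norm_snd_le (S (x₁, x₂))).trans (hS x₁ x₂ h₁ h₂)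
  refine le_antisymm (norm_add_le _ _) ?_
  rw [ContinuousLinearMap.norm_smulRight_apply]
  exact (add_le_add hG_norm (mul_le_mul_of_nonneg_right hφ_norm (norm_nonneg y))).trans hlower
end

section
/- Let X₁, X₂, Y₁, Y₂ be real Banach spaces and let G₁ : X₁ → Y₁ and G₂ : X₂ → Y₂ be Daugavet centers with ‖G₁‖ = ‖G₂‖ = 1. Then the operator G : X₁ ⊕₁ X₂ → Y₁ ⊕₁ Y₂ defined by G(x₁, x₂) = (G₁x₁, G₂x₂) is a Daugavet center, where ⊕₁ denotes the direct sum equipped with the sum norm ‖(u, v)‖ = ‖u‖ + ‖v‖. -/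
/-- In a nontrivial real normed space, every vector can be prolonged by any given length. -/
theorem exists_norm_sub_eq_and_norm_eq_add {E : Type*} [NormedAddCommGroup E] [NormedSpace ℝ E]
    [Nontrivial E] (y : E) {c : ℝ} (hc : 0 ≤ c) : ∃ w : E, ‖w - y‖ = c ∧ ‖w‖ = ‖y‖ + c := by
  by_cases hy : y = 0
  · obtain ⟨w, hw⟩ := exists_norm_eq E hc
    exact ⟨w, by simpa [hy] using hw, by simpa [hy] using hw⟩
  · have hy' : ‖y‖ ≠ 0 := norm_ne_zero_iff.mpr hy
    refine ⟨(1 + c / ‖y‖) • y, ?_, ?_⟩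
    · rw [add_smul, one_smul, add_sub_cancel_left, norm_smul, Real.norm_of_nonneg (by positivity)]
      field_simp
    · rw [norm_smul, Real.norm_of_nonneg (by positivity)]
      field_simp

/-- A Daugavet center stays extremal when a multiple of `|f x|` is added to the norm of the
perturbed operator. -/
theorem IsDaugavetCenter.norm_add_le_of_bound {X Y : Type*} [NormedAddCommGroup X]
    [NormedSpace ℝ X] [NormedAddCommGroup Y] [NormedSpace ℝ Y] [Nontrivial Y] {G : X →L[ℝ] Y}
    (hG : IsDaugavetCenter G) (f : X →L[ℝ] ℝ) (y : Y) {c K : ℝ} (hc : 0 ≤ c) (hK : 0 ≤ K)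
    (h : ∀ x, ‖G x + f x • y‖ + ‖f x‖ * c ≤ K * ‖x‖) : ‖G‖ + ‖f‖ * (‖y‖ + c) ≤ K := by
  obtain ⟨w, hwy, hw⟩ := exists_norm_sub_eq_and_norm_eq_add y hc
  rw [← hw, ← ContinuousLinearMap.norm_smulRight_apply, ← hG f w]
  refine ContinuousLinearMap.opNorm_le_bound _ hK fun x ↦ ?_
  calc ‖G x + f x • w‖ = ‖(G x + f x • y) + f x • (w - y)‖ := by congr 1; module
    _ ≤ ‖G x + f x • y‖ + ‖f x‖ * c := by
      rw [← hwy, ← norm_smul]; exact norm_add_le _ _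
    _ ≤ K * ‖x‖ := h x

/-- A space that is the codomain of an operator of norm one is nontrivial. -/
theorem ContinuousLinearMap.nontrivial_codomain_of_norm_eq_one {X Y : Type*}
    [NormedAddCommGroup X] [NormedSpace ℝ X] [NormedAddCommGroup Y] [NormedSpace ℝ Y]
    {G : X →L[ℝ] Y} (hG : ‖G‖ = 1) : Nontrivial Y := by
  by_contra hY
  rw [not_nontrivial_iff_subsingleton] at hY
  simp [Subsingleton.elim G 0] at hG

/-- The `⊕₁` sum of two norm-one Daugavet centers is a Daugavet center.
`WithLp 1 (X₁ × X₂)` is `X₁ × X₂` equipped with the norm `‖(u, v)‖ = ‖u‖ + ‖v‖`. -/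
theorem stmt14 {X₁ X₂ Y₁ Y₂ : Type*}
    [NormedAddCommGroup X₁] [NormedSpace ℝ X₁] [CompleteSpace X₁]
    [NormedAddCommGroup X₂] [NormedSpace ℝ X₂] [CompleteSpace X₂]
    [NormedAddCommGroup Y₁] [NormedSpace ℝ Y₁] [CompleteSpace Y₁]
    [NormedAddCommGroup Y₂] [NormedSpace ℝ Y₂] [CompleteSpace Y₂]
    (G₁ : X₁ →L[ℝ] Y₁) (G₂ : X₂ →L[ℝ] Y₂)
    (hG₁ : ‖G₁‖ = 1) (hG₂ : ‖G₂‖ = 1)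
    (hDC₁ : IsDaugavetCenter G₁) (hDC₂ : IsDaugavetCenter G₂) :
    IsDaugavetCenter
      (((WithLp.prodContinuousLinearEquiv 1 ℝ Y₁ Y₂).symm.toContinuousLinearMap).comp
        ((G₁.prodMap G₂).comp
          (WithLp.prodContinuousLinearEquiv 1 ℝ X₁ X₂).toContinuousLinearMap)) := by
  have := ContinuousLinearMap.nontrivial_codomain_of_norm_eq_one hG₁
  have := ContinuousLinearMap.nontrivial_codomain_of_norm_eq_one hG₂
  intro f y
  refine le_antisymm (norm_add_le _ _) ?_
  set e := (WithLp.prodContinuousLinearEquiv 1 ℝ X₁ X₂).symm.toContinuousLinearMap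
  set G := ((WithLp.prodContinuousLinearEquiv 1 ℝ Y₁ Y₂).symm.toContinuousLinearMap).comp
    ((G₁.prodMap G₂).comp (WithLp.prodContinuousLinearEquiv 1 ℝ X₁ X₂).toContinuousLinearMap)
    with hGdef
  set f₁ := f.comp (e.comp (ContinuousLinearMap.inl ℝ X₁ X₂)) with hf₁
  set f₂ := f.comp (e.comp (ContinuousLinearMap.inr ℝ X₁ X₂)) with hf₂
  have hG : ‖G‖ ≤ 1 := by
    refine ContinuousLinearMap.opNorm_le_bound _ zero_le_one fun x ↦ ?_
    have h₁ := G₁.le_opNorm x.fst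
    have h₂ := G₂.le_opNorm x.snd
    rw [hG₁] at h₁
    rw [hG₂] at h₂
    rw [WithLp.prod_norm_eq_of_L1, WithLp.prod_norm_eq_of_L1, mul_add]
    exact add_le_add h₁ h₂
  have hf : ‖f‖ ≤ max ‖f₁‖ ‖f₂‖ := by
    refine ContinuousLinearMap.opNorm_le_bound _ (by positivity) fun x ↦ ?_
    have hx : f x = f₁ x.fst + f₂ x.snd := by
      change f x = f (e (x.fst, 0)) + f (e (0, x.snd))
      rw [← map_add]
      congr 1
      apply WithLp.ofLp_injective
      ext <;> simp [e]
    rw [hx, WithLp.prod_norm_eq_of_L1, mul_add]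
    exact (norm_add_le _ _).trans (add_le_add
      (f₁.le_of_opNorm_le (le_max_left _ _) _) (f₂.le_of_opNorm_le (le_max_right _ _) _))
  have h₁ : 1 + ‖f₁‖ * ‖y‖ ≤ ‖G + f.smulRight y‖ := by
    rw [← hG₁, WithLp.prod_norm_eq_of_L1]
    refine hDC₁.norm_add_le_of_bound f₁ y.fst (norm_nonneg _) (norm_nonneg _) fun x ↦ ?_
    have h := (G + f.smulRight y).le_opNorm (WithLp.toLp 1 (x, 0))
    rw [WithLp.prod_norm_eq_of_L1, WithLp.prod_norm_eq_of_L1] at h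
    simpa [hGdef, hf₁, e, norm_smul] using h
  have h₂ : 1 + ‖f₂‖ * ‖y‖ ≤ ‖G + f.smulRight y‖ := by
    rw [← hG₂, WithLp.prod_norm_eq_of_L1, add_comm ‖y.fst‖]
    refine hDC₂.norm_add_le_of_bound f₂ y.snd (norm_nonneg _) (norm_nonneg _) fun x ↦ ?_
    have h := (G + f.smulRight y).le_opNorm (WithLp.toLp 1 (0, x))
    rw [WithLp.prod_norm_eq_of_L1, WithLp.prod_norm_eq_of_L1] at h
    simpa [hGdef, hf₂, e, norm_smul, add_comm] using h
  rw [ContinuousLinearMap.norm_smulRight_apply]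
  calc ‖G‖ + ‖f‖ * ‖y‖ ≤ 1 + max ‖f₁‖ ‖f₂‖ * ‖y‖ := by gcongr
    _ ≤ ‖G + f.smulRight y‖ := by
      rcases max_choice ‖f₁‖ ‖f₂‖ with h | h <;> rw [h] <;> assumption
end

section
/- Let X, Y and Y₁ be real Banach spaces and let G : X → Y be a Daugavet center with ‖G‖ = 1. Then the operator G̃ : X → Y ⊕₁ Y₁ defined by G̃x = (Gx, 0) is a Daugavet center, where Y ⊕₁ Y₁ denotes the direct sum equipped with the sum norm ‖(u, v)‖ = ‖u‖ + ‖v‖. -/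
theorem exists_norm_eq_one_and_eq_norm_smul {Y : Type*} [NormedAddCommGroup Y]
    [NormedSpace ℝ Y] [Nontrivial Y] (u : Y) : ∃ e : Y, ‖e‖ = 1 ∧ u = ‖u‖ • e := by
  rcases eq_or_ne u 0 with rfl | hu
  · obtain ⟨e, he⟩ := exists_norm_eq Y zero_le_one
    exact ⟨e, he, by simp⟩
  · exact ⟨‖u‖⁻¹ • u, norm_smul_inv_norm hu, (smul_inv_smul₀ (norm_ne_zero_iff.2 hu) u).symm⟩

/-- If `G : X → Y` is a norm-one Daugavet center, then `x ↦ (Gx, 0) : X → Y ⊕₁ Y₁`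
is a Daugavet center. `WithLp 1 (Y × Y₁)` is `Y × Y₁` with `‖(u, v)‖ = ‖u‖ + ‖v‖`. -/
theorem stmt15 {X Y Y₁ : Type*}
    [NormedAddCommGroup X] [NormedSpace ℝ X] [CompleteSpace X]
    [NormedAddCommGroup Y] [NormedSpace ℝ Y] [CompleteSpace Y]
    [NormedAddCommGroup Y₁] [NormedSpace ℝ Y₁] [CompleteSpace Y₁]
    (G : X →L[ℝ] Y) (hG : ‖G‖ = 1) (hDC : IsDaugavetCenter G) :
    IsDaugavetCenter
      (((WithLp.prodContinuousLinearEquiv 1 ℝ Y Y₁).symm.toContinuousLinearMap).comp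
        ((ContinuousLinearMap.inl ℝ Y Y₁).comp G)) := by
  intro x' y
  have norm_add_apply (x : X) : ‖(((WithLp.prodContinuousLinearEquiv 1 ℝ Y Y₁).symm
      |>.toContinuousLinearMap).comp ((ContinuousLinearMap.inl ℝ Y Y₁).comp G) +
        x'.smulRight y) x‖ = ‖G x + x' x • y.fst‖ + |x' x| * ‖y.snd‖ := by
    simp [WithLp.prod_norm_eq_of_L1, norm_smul]
  have norm_comp_le : ‖((WithLp.prodContinuousLinearEquiv 1 ℝ Y Y₁).symm.toContinuousLinearMap).comp
      ((ContinuousLinearMap.inl ℝ Y Y₁).comp G)‖ ≤ 1 := by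
    refine ContinuousLinearMap.opNorm_le_bound _ zero_le_one fun x => ?_
    simpa [WithLp.prod_norm_eq_of_L1, hG] using G.le_opNorm x
  refine le_antisymm (norm_add_le _ _) ((add_le_add_left norm_comp_le _).trans ?_)
  have : Nontrivial Y := by
    by_contra h
    rw [not_nontrivial_iff_subsingleton] at h
    simp [Subsingleton.elim G 0] at hG
  obtain ⟨e, he, hu⟩ := exists_norm_eq_one_and_eq_norm_smul y.fst
  have hw : ‖(‖y.fst‖ + ‖y.snd‖) • e‖ = ‖y‖ := by
    rw [norm_smul, he, mul_one, WithLp.prod_norm_eq_of_L1, Real.norm_of_nonneg (by positivity)]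
  have h := hDC x' ((‖y.fst‖ + ‖y.snd‖) • e)
  rw [hG, ContinuousLinearMap.norm_smulRight_apply, hw] at h
  rw [ContinuousLinearMap.norm_smulRight_apply, ← h]
  refine ContinuousLinearMap.opNorm_le_bound _ (norm_nonneg _) fun x => ?_
  refine le_trans ?_ (ContinuousLinearMap.le_opNorm _ x)
  rw [norm_add_apply]
  calc ‖(G + x'.smulRight ((‖y.fst‖ + ‖y.snd‖) • e)) x‖
      = ‖(G x + x' x • y.fst) + x' x • ‖y.snd‖ • e‖ := by
        conv_rhs => rw [hu]
        simp [add_smul, add_assoc]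
    _ ≤ ‖G x + x' x • y.fst‖ + ‖x' x • ‖y.snd‖ • e‖ := norm_add_le _ _
    _ = ‖G x + x' x • y.fst‖ + |x' x| * ‖y.snd‖ := by simp [norm_smul, he]
end

section
/- Let X be a real Banach space, K a nonempty compact Hausdorff topological space, C(K) the Banach space of real-valued continuous functions on K with the supremum norm, and G : X → C(K) a bounded linear operator with ‖G‖ = 1. Then G is a Daugavet center if and only if for every ε > 0, every nonempty open set U ⊆ K, every x* in the unit sphere S_{X*} of X*, and every s ∈ {−1, 1}, there exists x in the closed unit ball B_X with x*(x) ≥ 1 − ε and sup_{t ∈ U} s·(Gx)(t) > 1 − ε. -/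
/-- A continuous function attains its norm in absolute value, up to a choice of sign. -/
theorem ContinuousMap.exists_sign_mul_eq_norm {K : Type*} [TopologicalSpace K] [CompactSpace K]
    [Nonempty K] (f : C(K, ℝ)) : ∃ t, ∃ s : ℝ, (s = 1 ∨ s = -1) ∧ s * f t = ‖f‖ := by
  obtain ⟨t, -, ht⟩ := isCompact_univ.exists_isMaxOn (Set.univ_nonempty (α := K))
    (f.continuous.norm.continuousOn)
  have h : ‖f t‖ = ‖f‖ := le_antisymm (f.norm_coe_le_norm t)
    ((f.norm_le (norm_nonneg _)).2 fun u => ht (Set.mem_univ u))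
  rw [Real.norm_eq_abs] at h
  rcases abs_choice (f t) with h' | h'
  · exact ⟨t, 1, .inl rfl, by rw [one_mul, ← h', h]⟩
  · exact ⟨t, -1, .inr rfl, by rw [neg_one_mul, ← h', h]⟩

theorem ContinuousMap.sign_mul_le_norm {K : Type*} [TopologicalSpace K] [CompactSpace K]
    (f : C(K, ℝ)) (t : K) {s : ℝ} (hs : s = 1 ∨ s = -1) : s * f t ≤ ‖f‖ := by
  have h := abs_le.1 (f.norm_coe_le_norm t)
  rcases hs with rfl | rfl <;> linarith [h.1, h.2]

/-- An operator of norm one into `C(K)` is a Daugavet center as soon as its values nearly attain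
the norm on prescribed open sets along prescribed slices. -/
theorem isDaugavetCenter_of_slices {X K : Type*} [NormedAddCommGroup X] [NormedSpace ℝ X]
    [TopologicalSpace K] [CompactSpace K] [Nonempty K]
    (G : X →L[ℝ] C(K, ℝ)) (hG : ‖G‖ = 1)
    (h : ∀ ε : ℝ, 0 < ε → ∀ U : Set K, IsOpen U → U.Nonempty →
      ∀ x' : X →L[ℝ] ℝ, ‖x'‖ = 1 → ∀ s : ℝ, s = 1 ∨ s = -1 →
        ∃ x : X, ‖x‖ ≤ 1 ∧ x' x ≥ 1 - ε ∧
          sSup ((fun t => s * (G x) t) '' U) > 1 - ε) :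
    IsDaugavetCenter G := by
  have unit_case (x' : X →L[ℝ] ℝ) (hx' : ‖x'‖ = 1) (y : C(K, ℝ)) :
      1 + ‖y‖ ≤ ‖G + x'.smulRight y‖ := by
    obtain ⟨t₀, s, hs, ht₀⟩ := y.exists_sign_mul_eq_norm
    have key : ∀ ε : ℝ, 0 < ε → ε < 1 →
        (1 - ε) + ((1 - ε) * ‖y‖ - ε) ≤ ‖G + x'.smulRight y‖ := by
      intro ε hε hε1
      obtain ⟨x, hx, hxx, hsup⟩ := h ε hε {t | ‖y‖ - ε < s * y t}
        (isOpen_lt continuous_const (by fun_prop)) ⟨t₀, by simp [ht₀, hε]⟩ x' hx' s hs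
      obtain ⟨_, ⟨t, ht, rfl⟩, htG⟩ := exists_lt_of_lt_csSup
        (Set.Nonempty.image _ ⟨t₀, by simp [ht₀, hε]⟩) hsup
      have hle := ((G + x'.smulRight y) x).sign_mul_le_norm t hs
      have hop : ‖(G + x'.smulRight y) x‖ ≤ ‖G + x'.smulRight y‖ := by
        simpa using (G + x'.smulRight y).le_opNorm_of_le hx
      have hx1 : x' x ≤ 1 := by
        have := x'.le_opNorm_of_le hx
        rw [hx', mul_one] at this
        exact (le_abs_self _).trans this
      have heval : ((G + x'.smulRight y) x) t = G x t + x' x * y t := rfl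
      rw [heval] at hle
      simp only [Set.mem_ofPred_eq] at ht
      have h1 : x' x * (‖y‖ - ε) ≤ x' x * (s * y t) :=
        mul_le_mul_of_nonneg_left ht.le (by linarith)
      have h2 : (1 - ε) * ‖y‖ ≤ x' x * ‖y‖ := mul_le_mul_of_nonneg_right hxx (norm_nonneg y)
      have h3 : x' x * ε ≤ 1 * ε := mul_le_mul_of_nonneg_right hx1 hε.le
      linarith
    refine le_of_forall_pos_lt_add fun δ hδ => ?_
    have hy := norm_nonneg y
    have hpos : 0 < 3 + ‖y‖ + δ := by linarith
    have hmul : δ / (3 + ‖y‖ + δ) * (3 + ‖y‖ + δ) = δ := div_mul_cancel₀ _ hpos.ne'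
    have hε : 0 < δ / (3 + ‖y‖ + δ) := div_pos hδ hpos
    have := key _ hε ((div_lt_one hpos).2 (by linarith))
    nlinarith [mul_pos hε hδ]
  intro x' y
  refine le_antisymm (norm_add_le _ _) ?_
  rcases eq_or_ne x' 0 with rfl | hx0
  · simp
  have hn : ‖x'‖ ≠ 0 := norm_ne_zero_iff.2 hx0
  have hT : (‖x'‖⁻¹ • x').smulRight (‖x'‖ • y) = x'.smulRight y := by
    ext x : 1
    simp only [ContinuousLinearMap.smulRight_apply, smul_apply, smul_smul,
      smul_eq_mul]
    congr 1
    field_simp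
  have := unit_case (‖x'‖⁻¹ • x') (by simp [norm_smul, hn]) (‖x'‖ • y)
  rwa [hT, norm_smul, norm_norm, ← ContinuousLinearMap.norm_smulRight_apply, ← hG] at this

/-- A norm-one Daugavet center into `C(K)` nearly attains its norm on every nonempty open set
along every slice of the unit ball. -/
theorem IsDaugavetCenter.exists_mem_slice_s16 {X K : Type*} [NormedAddCommGroup X] [NormedSpace ℝ X]
    [TopologicalSpace K] [CompactSpace K] [T2Space K] [Nonempty K]
    {G : X →L[ℝ] C(K, ℝ)} (h : IsDaugavetCenter G) (hG : ‖G‖ = 1) {ε : ℝ} (hε : 0 < ε)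
    (hε1 : ε ≤ 1) {U : Set K} (hU : IsOpen U) (hne : U.Nonempty) {x' : X →L[ℝ] ℝ}
    (hx' : ‖x'‖ = 1) {s : ℝ} (hs : s = 1 ∨ s = -1) :
    ∃ x : X, ‖x‖ ≤ 1 ∧ 1 - ε < x' x ∧ ∃ t ∈ U, 1 - ε < s * G x t := by
  obtain ⟨t₀, ht₀⟩ := hne
  obtain ⟨y, hy0, hy1, hy⟩ := exists_continuous_zero_one_of_isClosed hU.isClosed_compl
    (isClosed_singleton (x := t₀)) (by simpa using ht₀)
  have hs1 : |s| = 1 := by rcases hs with rfl | rfl <;> simp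
  have hynorm : 1 ≤ ‖y‖ := by
    have := y.norm_coe_le_norm t₀
    rwa [hy1 rfl, Pi.one_apply, norm_one] at this
  have hnorm : 2 ≤ ‖G + x'.smulRight (s • y)‖ := by
    rw [h, ContinuousLinearMap.norm_smulRight_apply, norm_smul, Real.norm_eq_abs, hs1, hx', hG]
    linarith
  obtain ⟨x, hx, hxn⟩ := (G + x'.smulRight (s • y)).exists_lt_apply_of_lt_opNorm
    (show 2 - ε < _ by linarith)
  obtain ⟨t, r, hr, hrt⟩ := ((G + x'.smulRight (s • y)) x).exists_sign_mul_eq_norm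
  have hr1 : |r| = 1 := by rcases hr with rfl | rfl <;> simp
  have hss : s * s = 1 := by rcases hs with rfl | rfl <;> norm_num
  have hz : ‖(r * s) • x‖ ≤ 1 := by
    rw [norm_smul, Real.norm_eq_abs, abs_mul, hr1, hs1, one_mul, one_mul]
    exact hx.le
  have hsum : 2 - ε < s * G ((r * s) • x) t + x' ((r * s) • x) * y t := by
    rw [← hrt] at hxn
    simp only [add_apply, ContinuousLinearMap.smulRight_apply,
      ContinuousMap.add_apply, ContinuousMap.smul_apply, smul_eq_mul, map_smul] at hxn ⊢
    linear_combination hxn - r * G x t * hss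
  have ha : s * G ((r * s) • x) t ≤ 1 := ((G _).sign_mul_le_norm t hs).trans <| by
    simpa [hG] using G.le_opNorm_of_le hz
  have hb : x' ((r * s) • x) ≤ 1 := (le_abs_self _).trans <| by
    simpa [hx', -map_smul] using x'.le_opNorm_of_le hz
  obtain ⟨hyt0, hyt1⟩ := hy t
  have hbpos : 0 < x' ((r * s) • x) := by
    by_contra! hneg
    have := mul_nonpos_of_nonpos_of_nonneg hneg hyt0
    linarith
  have hby : x' ((r * s) • x) * y t ≤ x' ((r * s) • x) := mul_le_of_le_one_right hbpos.le hyt1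
  have hby1 := mul_le_of_le_one_left hyt0 hb
  refine ⟨(r * s) • x, hz, by linarith, t, ?_, by linarith⟩
  by_contra htU
  have : y t = 0 := hy0 htU
  linarith

theorem stmt16 {X K : Type*} [NormedAddCommGroup X] [NormedSpace ℝ X] [CompleteSpace X]
    [TopologicalSpace K] [CompactSpace K] [T2Space K] [Nonempty K]
    (G : X →L[ℝ] C(K, ℝ)) (hG : ‖G‖ = 1) :
    IsDaugavetCenter G ↔
      ∀ ε : ℝ, 0 < ε → ∀ U : Set K, IsOpen U → U.Nonempty →
        ∀ x' : X →L[ℝ] ℝ, ‖x'‖ = 1 → ∀ s : ℝ, s = 1 ∨ s = -1 →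
          ∃ x : X, ‖x‖ ≤ 1 ∧ x' x ≥ 1 - ε ∧
            sSup ((fun t => s * (G x) t) '' U) > 1 - ε := by
  refine ⟨fun h ε hε U hU hne x' hx' s hs => ?_, isDaugavetCenter_of_slices G hG⟩
  obtain ⟨x, hx, hxx, t, ht, hGt⟩ :=
    h.exists_mem_slice_s16 hG (lt_min hε one_pos) (min_le_right ε 1) hU hne hx' hs
  have hmin := min_le_left ε 1
  refine ⟨x, hx, by linarith, lt_of_lt_of_le (by linarith) (le_csSup ?_ ⟨t, ht, rfl⟩)⟩
  refine ⟨‖G x‖, Set.forall_mem_image.2 fun u _ => ?_⟩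
  exact (G x).sign_mul_le_norm u hs
end

section
/- Let K₁ and K₂ be nonempty compact Hausdorff topological spaces without isolated points, and let φ : K₂ → K₁ be a continuous map such that for every t ∈ K₁ the preimage φ⁻¹({t}) is nowhere dense in K₂. Then the composition operator G_φ : C(K₁) → C(K₂) defined by G_φ f = f ∘ φ is a Daugavet center, where C(K) denotes the Banach space of real-valued continuous functions on K with the supremum norm. -/
/-- A functional on `C(K, ℝ)` is almost unaffected by a suitable bump modification: any `f` in
the unit ball can be changed, within the unit ball, to take a prescribed value `c` at some point
of a given infinite set, while moving `x' f` by less than `δ`. -/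
theorem ContinuousMap.exists_eq_abs_map_sub_lt_of_infinite {K : Type*} [TopologicalSpace K]
    [CompactSpace K] [T2Space K] {A : Set K} (hA : A.Infinite) (x' : C(K, ℝ) →L[ℝ] ℝ)
    {f : C(K, ℝ)} (hf : ‖f‖ ≤ 1) {c : ℝ} (hc : |c| ≤ 1) {δ : ℝ} (hδ : 0 < δ) :
    ∃ t ∈ A, ∃ g : C(K, ℝ), ‖g‖ ≤ 1 ∧ g t = c ∧ |x' g - x' f| < δ := by
  obtain ⟨n, hn⟩ := exists_nat_gt (‖x'‖ * 2 / δ)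
  obtain ⟨s, hsA, hcard⟩ := hA.exists_subset_card_eq n
  obtain ⟨U, hU, hdisj⟩ := s.finite_toSet.t2_separation
  have bump (t : K) : ∃ h : C(K, ℝ), Set.EqOn h 0 (U t)ᶜ ∧ h t = 1 ∧
      ∀ x, h x ∈ Set.Icc (0 : ℝ) 1 := by
    obtain ⟨h, h0, h1, hI⟩ := exists_continuous_zero_one_of_isClosed
      (hU t).2.isClosed_compl (isClosed_singleton (x := t)) (by simpa using (hU t).1)
    exact ⟨h, h0, h1 rfl, hI⟩
  choose h h0 h1 hI using bump
  have hfx (x : K) : |f x| ≤ 1 := (f.norm_coe_le_norm x).trans hf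
  have hsum (x : K) : ∑ t ∈ s, h t x ≤ 1 := by
    by_cases hx : ∃ t ∈ s, x ∈ U t
    · obtain ⟨t, ht, hxt⟩ := hx
      rw [Finset.sum_eq_single_of_mem t ht]
      · exact (hI t x).2
      · intro u hu hut
        exact h0 u fun hxu => Set.disjoint_left.1 (hdisj hu ht hut) hxu hxt
    · push Not at hx
      rw [Finset.sum_eq_zero fun t ht => h0 t (hx t ht)]
      exact zero_le_one
  let d (t : K) : C(K, ℝ) := h t * (ContinuousMap.const K c - f)
  have hd (x : K) : |c - f x| ≤ 2 := by
    have := abs_sub c (f x)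
    linarith [hfx x]
  have htotal : ∑ t ∈ s, |x' (d t)| ≤ ‖x'‖ * 2 := by
    have hnorm : ‖∑ t ∈ s, (SignType.sign (x' (d t)) : ℝ) • d t‖ ≤ 2 := by
      refine (ContinuousMap.norm_le _ zero_le_two).2 fun x => ?_
      rw [ContinuousMap.sum_apply]
      calc ‖∑ t ∈ s, ((SignType.sign (x' (d t)) : ℝ) • d t) x‖
          ≤ ∑ t ∈ s, h t x * 2 := by
            refine norm_sum_le_of_le _ fun t _ => ?_
            have hs : |(SignType.sign (x' (d t)) : ℝ)| ≤ 1 := by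
              cases SignType.sign (x' (d t)) <;> simp
            simp only [d, ContinuousMap.smul_apply, ContinuousMap.mul_apply,
              ContinuousMap.sub_apply, ContinuousMap.const_apply, smul_eq_mul, Real.norm_eq_abs,
              abs_mul, abs_of_nonneg (hI t x).1]
            have := mul_le_mul_of_nonneg_left (hd x) (hI t x).1
            have := mul_nonneg (hI t x).1 (abs_nonneg (c - f x))
            nlinarith
        _ = (∑ t ∈ s, h t x) * 2 := by rw [Finset.sum_mul]
        _ ≤ 2 := by linarith [hsum x]
    calc ∑ t ∈ s, |x' (d t)| = x' (∑ t ∈ s, (SignType.sign (x' (d t)) : ℝ) • d t) := by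
          simp only [map_sum, map_smul, smul_eq_mul, sign_mul_self]
      _ ≤ ‖x'‖ * ‖∑ t ∈ s, (SignType.sign (x' (d t)) : ℝ) • d t‖ :=
          (le_abs_self _).trans (x'.le_opNorm _)
      _ ≤ ‖x'‖ * 2 := by gcongr
  obtain ⟨t, ht, htδ⟩ : ∃ t ∈ s, |x' (d t)| < δ := by
    by_contra! hcon
    have := s.card_nsmul_le_sum _ _ hcon
    rw [hcard, nsmul_eq_mul] at this
    rw [div_lt_iff₀ hδ] at hn
    linarith
  refine ⟨t, hsA ht, f + d t, ?_, ?_, by simpa using htδ⟩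
  · refine (ContinuousMap.norm_le _ zero_le_one).2 fun x => ?_
    have hconv := (convex_Icc (-1 : ℝ) 1) (abs_le.1 (hfx x)) (abs_le.1 hc)
      (sub_nonneg.2 (hI t x).2) (hI t x).1 (sub_add_cancel _ _)
    have heq : (f + d t) x = (1 - h t x) • f x + h t x • c := by
      simp only [d, ContinuousMap.add_apply, ContinuousMap.mul_apply, ContinuousMap.sub_apply,
        ContinuousMap.const_apply, smul_eq_mul]
      ring
    rw [heq]
    exact abs_le.2 hconv
  · simp [d, h1]

/-- The union of two nowhere dense sets is nowhere dense. -/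
theorem IsNowhereDense.union {X : Type*} [TopologicalSpace X] {s t : Set X}
    (hs : IsNowhereDense s) (ht : IsNowhereDense t) : IsNowhereDense (s ∪ t) := by
  rw [IsNowhereDense, closure_union,
    interior_union_isClosed_of_interior_empty isClosed_closure ht]
  exact hs

/-- A finite union of nowhere dense sets is nowhere dense. -/
theorem Set.Finite.isNowhereDense_biUnion {X ι : Type*} [TopologicalSpace X] {I : Set ι}
    (hI : I.Finite) {s : ι → Set X} (hs : ∀ i ∈ I, IsNowhereDense (s i)) :
    IsNowhereDense (⋃ i ∈ I, s i) := by
  induction I, hI using Set.Finite.induction_on with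
  | empty => simp
  | insert _ _ ih =>
    rw [Set.biUnion_insert]
    exact (hs _ (Set.mem_insert _ _)).union (ih fun i hi => hs i (Set.mem_insert_of_mem _ hi))

/-- If all fibers of `φ` are nowhere dense, nonempty open sets have infinite images. -/
theorem IsOpen.infinite_image_of_isNowhereDense_preimage {X Y : Type*} [TopologicalSpace X]
    {φ : X → Y} (hφ : ∀ t, IsNowhereDense (φ ⁻¹' {t})) {U : Set X} (hU : IsOpen U)
    (hne : U.Nonempty) : (φ '' U).Infinite := by
  intro hfin
  have hnd : IsNowhereDense (⋃ t ∈ φ '' U, φ ⁻¹' {t}) :=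
    hfin.isNowhereDense_biUnion fun t _ => hφ t
  have hsub : U ⊆ ⋃ t ∈ φ '' U, φ ⁻¹' {t} := fun x hx =>
    Set.mem_biUnion (Set.mem_image_of_mem φ hx) rfl
  have := interior_maximal (hsub.trans subset_closure) hU
  rw [hnd] at this
  exact hne.not_subset_empty this

/-- If `K₁, K₂` are compact Hausdorff spaces without isolated points and
`φ : K₂ → K₁` is continuous with all fibers nowhere dense, then the composition
operator `G_φ : C(K₁) → C(K₂)`, `f ↦ f ∘ φ`, is a Daugavet center. -/
theorem stmt17 {K₁ K₂ : Type*}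
    [TopologicalSpace K₁] [CompactSpace K₁] [T2Space K₁] [Nonempty K₁]
    [TopologicalSpace K₂] [CompactSpace K₂] [T2Space K₂] [Nonempty K₂]
    (h₁ : ∀ t : K₁, Filter.NeBot (nhdsWithin t {t}ᶜ))
    (h₂ : ∀ t : K₂, Filter.NeBot (nhdsWithin t {t}ᶜ))
    (φ : C(K₂, K₁)) (hφ : ∀ t : K₁, IsNowhereDense (φ ⁻¹' {t}))
    (Gφ : C(K₁, ℝ) →L[ℝ] C(K₂, ℝ)) (hGφ : ∀ f : C(K₁, ℝ), Gφ f = f.comp φ) :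
    IsDaugavetCenter Gφ := by
  intro x' y
  refine le_antisymm (norm_add_le _ _) ?_
  rw [ContinuousLinearMap.norm_smulRight_apply]
  have hG : ‖Gφ‖ ≤ 1 := by
    refine Gφ.opNorm_le_bound zero_le_one fun f => ?_
    rw [hGφ, one_mul]
    exact (ContinuousMap.norm_le _ (norm_nonneg f)).2 fun x => f.norm_coe_le_norm _
  have key (ε : ℝ) (hε : 0 < ε) :
      1 + ‖x'‖ * ‖y‖ ≤ ‖Gφ + x'.smulRight y‖ + ε * (‖x'‖ + 2 * ‖y‖) := by
    obtain ⟨f, hf, hxf⟩ : ∃ f : C(K₁, ℝ), ‖f‖ ≤ 1 ∧ ‖x'‖ - ε < x' f := by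
      obtain ⟨f, hf, hxf⟩ := x'.exists_lt_apply_of_lt_opNorm (sub_lt_self ‖x'‖ hε)
      rcases lt_abs.1 hxf with hxf | hxf
      · exact ⟨f, hf.le, hxf⟩
      · exact ⟨-f, by simpa using hf.le, by simpa using hxf⟩
    obtain ⟨s₀, hs₀⟩ : ∃ s, ‖y‖ - ε < |y s| := by
      by_contra! hcon
      linarith [(ContinuousMap.norm_le_of_nonempty y).2 hcon]
    obtain ⟨σ, hσ, hσs₀⟩ : ∃ σ : ℝ, |σ| = 1 ∧ ‖y‖ - ε < σ * y s₀ := by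
      rcases lt_abs.1 hs₀ with h | h
      · exact ⟨1, by simp, by simpa using h⟩
      · exact ⟨-1, by simp, by simpa using h⟩
    have hU : IsOpen {s | ‖y‖ - ε < σ * y s} :=
      isOpen_lt continuous_const (continuous_const.mul y.continuous)
    obtain ⟨_, ⟨s, hs, rfl⟩, g, hg, hgs, hgf⟩ :=
      ContinuousMap.exists_eq_abs_map_sub_lt_of_infinite
        (hU.infinite_image_of_isNowhereDense_preimage hφ ⟨s₀, hσs₀⟩) x' hf hσ.le hε
    have hs : ‖y‖ - ε < σ * y s := hs
    have hp : ‖x'‖ - 2 * ε ≤ x' g := by linarith [(abs_lt.1 hgf).1]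
    have hσσ : σ * σ = 1 := by rw [← abs_mul_abs_self, hσ, one_mul]
    have hys : |σ * y s| ≤ ‖y‖ := by
      rw [abs_mul, hσ, one_mul]
      exact y.norm_coe_le_norm s
    have hnorm : |σ * ((Gφ + x'.smulRight y) g) s| ≤ ‖Gφ + x'.smulRight y‖ := by
      rw [abs_mul, hσ, one_mul]
      exact (ContinuousMap.norm_coe_le_norm _ s).trans
        ((Gφ + x'.smulRight y).unit_le_opNorm g hg)
    have hval : σ * ((Gφ + x'.smulRight y) g) s = 1 + x' g * (σ * y s) := by
      simp only [add_apply, hGφ, ContinuousLinearMap.smulRight_apply,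
        ContinuousMap.add_apply, ContinuousMap.comp_apply, ContinuousMap.smul_apply, hgs,
        smul_eq_mul]
      linear_combination hσσ
    rw [hval] at hnorm
    have hlow : 1 + x' g * (σ * y s) ≤ ‖Gφ + x'.smulRight y‖ := (le_abs_self _).trans hnorm
    have hpabs : x' g ≤ ‖x'‖ := (le_abs_self _).trans (x'.unit_le_opNorm g hg)
    nlinarith [mul_nonneg (norm_nonneg x') (sub_nonneg.2 hs.le),
      mul_nonneg (sub_nonneg.2 hpabs) (sub_nonneg.2 ((le_abs_self _).trans hys)),
      mul_nonneg (sub_nonneg.2 hp) (norm_nonneg y)]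
  refine le_of_forall_pos_le_add fun δ hδ => ?_
  have hpos : 0 < ‖x'‖ + 2 * ‖y‖ + 1 := by positivity
  have hle : δ / (‖x'‖ + 2 * ‖y‖ + 1) * (‖x'‖ + 2 * ‖y‖) ≤ δ := by
    rw [div_mul_eq_mul_div, div_le_iff₀ hpos]
    nlinarith
  linarith [key _ (div_pos hδ hpos)]
end

section
/- Let C([−1,1]) denote the Banach space of real-valued continuous functions on the interval [−1, 1] with the supremum norm, and let G : C([−1,1]) → C([−1,1]) be the bounded linear operator defined by (Gf)(x) = (f(x) + f(−x))/2. Then G is a Daugavet center. -/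
/-- A bounded functional on `C(X, ℝ)` sends a family with `∑ |h n| ≤ C` pointwise
to a family of reals whose absolute values have sum at most `‖φ‖ * C`. -/
theorem ContinuousMap.sum_abs_apply_le {X ι : Type*} [TopologicalSpace X] [CompactSpace X]
    (φ : C(X, ℝ) →L[ℝ] ℝ) (s : Finset ι) (h : ι → C(X, ℝ)) {C : ℝ} (hC : 0 ≤ C)
    (hh : ∀ x, ∑ n ∈ s, |h n x| ≤ C) : ∑ n ∈ s, |φ (h n)| ≤ ‖φ‖ * C := by
  have hsum : ∑ n ∈ s, |φ (h n)| = φ (∑ n ∈ s, (SignType.sign (φ (h n)) : ℝ) • h n) := by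
    simp only [map_sum, map_smul, smul_eq_mul, sign_mul_self]
  rw [hsum]
  refine (le_abs_self _).trans (φ.le_opNorm_of_le ?_)
  rw [ContinuousMap.norm_le _ hC]
  intro x
  rw [ContinuousMap.sum_apply]
  refine (norm_sum_le _ _).trans ((Finset.sum_le_sum fun n _ => ?_).trans (hh x))
  rw [ContinuousMap.smul_apply, smul_eq_mul, norm_mul, Real.norm_eq_abs, Real.norm_eq_abs]
  refine mul_le_of_le_one_left (abs_nonneg _) ?_
  rcases SignType.sign (φ (h n)) with _ | _ | _ <;> simp

/-- Disjointly supported tents of width one, centred at the integers. -/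
theorem sum_tent_le_one (s : Finset ℕ) (z : ℝ) :
    ∑ n ∈ s, max 0 (1 - 2 * |z - n|) ≤ 1 := by
  by_cases h : ∃ m ∈ s, |z - (m : ℝ)| < 1 / 2
  · obtain ⟨m, hm, hzm⟩ := h
    rw [Finset.sum_eq_single_of_mem m hm]
    · exact max_le zero_le_one (by linarith [abs_nonneg (z - (m : ℝ))])
    · intro n _ hnm
      refine max_eq_left ?_
      by_contra! hlt
      have hzn : |z - (n : ℝ)| < 1 / 2 := by linarith
      rw [abs_lt] at hzm hzn
      have h₁ : (n : ℝ) < m + 1 := by linarith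
      have h₂ : (m : ℝ) < n + 1 := by linarith
      norm_cast at h₁ h₂
      omega
  · push Not at h
    rw [Finset.sum_eq_zero]
    · exact zero_le_one
    · intro n hn
      exact max_eq_left (by linarith [h n hn])

/-- An element of the unit ball of `C([-1, 1])` can be modified to take the value `σ = ±1` on a
symmetric pair `{t, -t}` with `t ∈ [a, b]`, almost without changing the value of a functional. -/
theorem exists_eq_on_symm_pair_of_norm_le_one
    (φ : C(Set.Icc (-1 : ℝ) 1, ℝ) →L[ℝ] ℝ) (f : C(Set.Icc (-1 : ℝ) 1, ℝ)) (hf : ‖f‖ ≤ 1)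
    {σ : ℝ} (hσ : |σ| = 1) {a b : ℝ} (hab : a < b) {ε : ℝ} (hε : 0 < ε) :
    ∃ t ∈ Set.Icc a b, ∃ g : C(Set.Icc (-1 : ℝ) 1, ℝ), ‖g‖ ≤ 1 ∧
      (∀ x : Set.Icc (-1 : ℝ) 1, |(x : ℝ)| = t → g x = σ) ∧ |φ g - φ f| < ε := by
  obtain ⟨N, hN⟩ := exists_nat_gt (‖φ‖ * 2 / ε)
  have hN0 : (0 : ℝ) < N := lt_of_le_of_lt (by positivity) hN
  have hba : 0 < b - a := sub_pos.2 hab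
  let τ : ℕ → C(Set.Icc (-1 : ℝ) 1, ℝ) := fun n =>
    ⟨fun x : Set.Icc (-1 : ℝ) 1 => max 0 (1 - 2 * |(|(x : ℝ)| - a) * (N / (b - a)) - n|),
      by fun_prop⟩
  have hτ0 : ∀ n (x : Set.Icc (-1 : ℝ) 1), 0 ≤ τ n x := fun n x => le_max_left _ _
  have hτ1 : ∀ n (x : Set.Icc (-1 : ℝ) 1), τ n x ≤ 1 := fun n x =>
    max_le zero_le_one (by linarith [abs_nonneg ((|(x : ℝ)| - a) * (N / (b - a)) - n)])
  have hfx : ∀ x, |f x| ≤ 1 := fun x => (f.norm_coe_le_norm x).trans hf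
  let h : ℕ → C(Set.Icc (-1 : ℝ) 1, ℝ) := fun n => τ n * (ContinuousMap.const _ σ - f)
  have hh : ∀ n x, h n x = τ n x * (σ - f x) := fun n x => rfl
  have hsum : ∑ n ∈ Finset.range N, |φ (h n)| ≤ ‖φ‖ * 2 := by
    refine ContinuousMap.sum_abs_apply_le φ _ h zero_le_two fun x => ?_
    calc ∑ n ∈ Finset.range N, |h n x| ≤ ∑ n ∈ Finset.range N, τ n x * 2 := by
          refine Finset.sum_le_sum fun n _ => ?_
          rw [hh, abs_mul, abs_of_nonneg (hτ0 n x)]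
          refine mul_le_mul_of_nonneg_left ?_ (hτ0 n x)
          linarith [abs_sub σ (f x), hfx x]
      _ = (∑ n ∈ Finset.range N, τ n x) * 2 := (Finset.sum_mul _ _ _).symm
      _ ≤ 2 := by
          have : ∑ n ∈ Finset.range N, τ n x ≤ 1 :=
            sum_tent_le_one (Finset.range N) ((|(x : ℝ)| - a) * (N / (b - a)))
          linarith
  obtain ⟨n, hn, hsmall⟩ : ∃ n ∈ Finset.range N, |φ (h n)| < ε := by
    by_contra! hge
    have hcard := Finset.card_nsmul_le_sum _ _ _ hge
    rw [Finset.card_range, nsmul_eq_mul] at hcard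
    rw [div_lt_iff₀ hε] at hN
    linarith
  have hnN : (n : ℝ) ≤ N := by exact_mod_cast (Finset.mem_range.1 hn).le
  refine ⟨a + n * ((b - a) / N), ⟨?_, ?_⟩, f + h n, ?_, ?_, ?_⟩
  · exact le_add_of_nonneg_right (by positivity)
  · have : (n : ℝ) * ((b - a) / N) ≤ N * ((b - a) / N) := by gcongr
    rw [mul_div_cancel₀ _ hN0.ne'] at this
    linarith
  · rw [ContinuousMap.norm_le _ zero_le_one]
    intro x
    have h₁ := abs_le.1 (hfx x)
    have h₂ := abs_le.1 hσ.le
    rw [ContinuousMap.add_apply, hh, Real.norm_eq_abs, abs_le]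
    constructor <;> nlinarith [hτ0 n x, hτ1 n x]
  · intro x hx
    have hτx : τ n x = 1 := by
      change max 0 (1 - 2 * |(|(x : ℝ)| - a) * (N / (b - a)) - n|) = 1
      have : (|(x : ℝ)| - a) * (N / (b - a)) - n = 0 := by
        rw [hx]
        field_simp
        ring
      simp [this]
    rw [ContinuousMap.add_apply, hh, hτx]
    ring
  · simpa using hsmall

/-- The absolute values of the points where a continuous function on `[-1, 1]` exceeds a constant
fill a nondegenerate segment, as soon as there is such a point. -/
theorem exists_Icc_forall_exists_abs_eq_and_lt (y : C(Set.Icc (-1 : ℝ) 1, ℝ))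
    (x₀ : Set.Icc (-1 : ℝ) 1) {c : ℝ} (hc : c < y x₀) :
    ∃ a b : ℝ, a < b ∧
      ∀ t ∈ Set.Icc a b, ∃ x : Set.Icc (-1 : ℝ) 1, |(x : ℝ)| = t ∧ c < y x := by
  obtain ⟨δ, hδ, hball⟩ := Metric.mem_nhds_iff.1
    (y.continuous.continuousAt.eventually (lt_mem_nhds hc))
  have hx₀ : |(x₀ : ℝ)| ≤ 1 := abs_le.2 x₀.2
  have habs := abs_nonneg (x₀ : ℝ)
  obtain ⟨ρ, hρ, hρx⟩ : ∃ ρ : ℝ, |ρ| = 1 ∧ (x₀ : ℝ) = ρ * |(x₀ : ℝ)| := by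
    rcases le_total 0 (x₀ : ℝ) with h | h
    · exact ⟨1, by simp, by rw [abs_of_nonneg h, one_mul]⟩
    · exact ⟨-1, by simp, by rw [abs_of_nonpos h]; ring⟩
  refine ⟨max 0 (|(x₀ : ℝ)| - δ / 2), min 1 (|(x₀ : ℝ)| + δ / 2), ?_, fun t ht => ?_⟩
  · exact max_lt (lt_min one_pos (by linarith)) (lt_min (by linarith) (by linarith))
  · have ht0 : 0 ≤ t := (le_max_left _ _).trans ht.1
    have ht1 : t ≤ 1 := ht.2.trans (min_le_left _ _)
    have hta : |(x₀ : ℝ)| - δ / 2 ≤ t := (le_max_right _ _).trans ht.1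
    have htb : t ≤ |(x₀ : ℝ)| + δ / 2 := ht.2.trans (min_le_right _ _)
    have hρt : |ρ * t| = t := by rw [abs_mul, hρ, one_mul, abs_of_nonneg ht0]
    refine ⟨⟨ρ * t, abs_le.1 (hρt.trans_le ht1)⟩, hρt, hball ?_⟩
    rw [Metric.mem_ball, Subtype.dist_eq, Real.dist_eq, hρx, ← mul_sub, abs_mul, hρ, one_mul,
      abs_lt]
    constructor <;> linarith

theorem ContinuousMap.exists_sign_mul_apply_eq_norm {X : Type*} [TopologicalSpace X]
    [CompactSpace X] [Nonempty X] (y : C(X, ℝ)) :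
    ∃ x, ∃ σ : ℝ, |σ| = 1 ∧ σ * σ = 1 ∧ σ * y x = ‖y‖ := by
  obtain ⟨x, -, hx⟩ := isCompact_univ.exists_isMaxOn Set.univ_nonempty
    (y.continuous.norm.continuousOn)
  have hy : |y x| = ‖y‖ := le_antisymm (y.norm_coe_le_norm x)
    ((ContinuousMap.norm_le _ (abs_nonneg _)).2 fun z => hx (Set.mem_univ z))
  refine ⟨x, ?_⟩
  rcases le_total 0 (y x) with h | h
  · exact ⟨1, by simp, by simp, by rw [← hy, abs_of_nonneg h, one_mul]⟩
  · exact ⟨-1, by simp, by simp, by rw [← hy, abs_of_nonpos h, neg_one_mul]⟩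

/-- The symmetrization operator `(Gf)(x) = (f(x) + f(-x))/2` on `C([-1, 1])`
is a Daugavet center. -/
theorem stmt18
    (G : C(Set.Icc (-1 : ℝ) 1, ℝ) →L[ℝ] C(Set.Icc (-1 : ℝ) 1, ℝ))
    (hGdef : ∀ (f : C(Set.Icc (-1 : ℝ) 1, ℝ)) (x : Set.Icc (-1 : ℝ) 1)
      (hx : -(x : ℝ) ∈ Set.Icc (-1 : ℝ) 1),
      (G f) x = (f x + f ⟨-(x : ℝ), hx⟩) / 2) :
    IsDaugavetCenter G := by
  intro φ y
  refine le_antisymm (norm_add_le _ _) ?_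
  have hneg : ∀ x : Set.Icc (-1 : ℝ) 1, -(x : ℝ) ∈ Set.Icc (-1 : ℝ) 1 := fun x =>
    ⟨neg_le_neg x.2.2, neg_le.1 x.2.1⟩
  have hG : ‖G‖ ≤ 1 := by
    refine G.opNorm_le_bound zero_le_one fun f => ?_
    rw [one_mul, ContinuousMap.norm_le _ (norm_nonneg f)]
    intro x
    have h₁ := abs_le.1 (f.norm_coe_le_norm x)
    have h₂ := abs_le.1 (f.norm_coe_le_norm ⟨-(x : ℝ), hneg x⟩)
    rw [hGdef f x (hneg x), Real.norm_eq_abs, abs_le]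
    constructor <;> linarith
  rw [ContinuousLinearMap.norm_smulRight_apply]
  refine (add_le_add_left hG _).trans (le_of_forall_pos_le_add fun η hη => ?_)
  have hφ := norm_nonneg φ
  have hy := norm_nonneg y
  obtain ⟨ε, hε, hεη⟩ : ∃ ε : ℝ, 0 < ε ∧ ε * (2 * ‖y‖ + ‖φ‖) ≤ η := by
    refine ⟨η / (2 * ‖y‖ + ‖φ‖ + 1), by positivity, ?_⟩
    rw [div_mul_eq_mul_div, div_le_iff₀ (by positivity)]
    nlinarith
  have : Nonempty (Set.Icc (-1 : ℝ) 1) := ⟨⟨0, by norm_num⟩⟩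
  obtain ⟨x₀, σ, hσ, hσσ, hσy⟩ := y.exists_sign_mul_apply_eq_norm
  obtain ⟨a, b, hab, hseg⟩ := exists_Icc_forall_exists_abs_eq_and_lt (σ • y) x₀
    (show ‖y‖ - ε < (σ • y) x₀ by
      rw [ContinuousMap.smul_apply, smul_eq_mul, hσy]; linarith)
  obtain ⟨f, hf, hφf⟩ : ∃ f, ‖f‖ ≤ 1 ∧ ‖φ‖ - ε < φ f := by
    obtain ⟨f, hf, hφf⟩ := φ.exists_lt_apply_of_lt_opNorm (sub_lt_self ‖φ‖ hε)
    rcases lt_abs.1 hφf with h | h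
    · exact ⟨f, hf.le, h⟩
    · exact ⟨-f, by rw [norm_neg]; exact hf.le, by rwa [map_neg]⟩
  obtain ⟨t, ht, g, hg, hgσ, hgf⟩ := exists_eq_on_symm_pair_of_norm_le_one φ f hf hσ hab hε
  obtain ⟨x, hxt, hyx⟩ := hseg t ht
  rw [ContinuousMap.smul_apply, smul_eq_mul] at hyx
  have hGg : G g x = σ := by
    rw [hGdef g x (hneg x), hgσ x hxt, hgσ ⟨-(x : ℝ), hneg x⟩ ((abs_neg _).trans hxt)]
    ring
  have hle : σ * (G g x + φ g * y x) ≤ ‖G + φ.smulRight y‖ := by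
    refine (le_abs_self _).trans ?_
    rw [abs_mul, hσ, one_mul]
    exact (((G + φ.smulRight y) g).norm_coe_le_norm x).trans
      ((G + φ.smulRight y).unit_le_opNorm g hg)
  rw [hGg, mul_add, hσσ] at hle
  have hφg : φ g ≤ ‖φ‖ := (le_abs_self _).trans (φ.unit_le_opNorm g hg)
  have hφg' : ‖φ‖ - 2 * ε ≤ φ g := by linarith [(abs_lt.1 hgf).1]
  have hyx' : σ * y x ≤ ‖y‖ := by
    refine (le_abs_self _).trans ?_
    rw [abs_mul, hσ, one_mul]
    exact y.norm_coe_le_norm x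
  have h₁ : (‖φ‖ - φ g) * ‖y‖ ≤ 2 * ε * ‖y‖ := by gcongr; linarith
  have h₂ : φ g * (‖y‖ - σ * y x) ≤ ‖φ‖ * (‖y‖ - σ * y x) :=
    mul_le_mul_of_nonneg_right hφg (by linarith)
  have h₃ : ‖φ‖ * (‖y‖ - σ * y x) ≤ ‖φ‖ * ε := by gcongr; linarith
  nlinarith
end
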